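/- arXiv:2601.21620 — 2 statements merged into one kernel-verified Lean document; each statement's English description precedes it below -/
import Mathlib

section
/- Let d ≥ 1, 1 ≤ q < ∞ and α, β > 0. There exists a constant C such that ‖f‖_q ≤ C ‖ |x|^α f ‖_q^{β/(α+β)} ‖ |ξ|^β f̂ ‖_{q′}^{α/(α+β)} for all Schwartz functions f on ℝ^d if and only if: β > d(1/q − 1/2) in case q < 2, and (no further condition, i.e. always, given β > 0) in case q ≥ 2. -/
open MeasureTheory
open scoped ENNReal FourierTransform

theorem eLpNorm_comp_smul_eq {E F : Type*} [NormedAddCommGroup E] [NormedSpace ℝ E]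
    [FiniteDimensional ℝ E] [MeasurableSpace E] [BorelSpace E] [NormedAddCommGroup F]
    (μ : Measure E) [μ.IsAddHaarMeasure] (h : E → F) (p : ℝ≥0∞) {r : ℝ} (hr : 0 < r) :
    eLpNorm (fun x => h (r • x)) p μ =
      ENNReal.ofReal (r ^ (-(Module.finrank ℝ E : ℝ) * p⁻¹.toReal)) * eLpNorm h p μ := by
  rcases eq_or_ne p 0 with rfl | hp
  · simp
  have he : MeasurableEmbedding (fun x : E => r • x) :=
    (Homeomorph.smulOfNeZero r hr.ne').measurableEmbedding
  have h1 : eLpNorm (fun x => h (r • x)) p μ = eLpNorm h p (μ.map (fun x => r • x)) :=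
    (he.eLpNorm_map_measure).symm
  rw [h1, Measure.map_addHaar_smul μ hr.ne']
  have hc : 0 < |(r ^ Module.finrank ℝ E)⁻¹| := by positivity
  rcases eq_or_ne p ∞ with rfl | hp'
  · rw [eLpNorm_exponent_top, eLpNormEssSup_ennreal_smul_measure (ENNReal.ofReal_pos.2 hc).ne']
    simp
  · rw [eLpNorm_smul_measure_of_ne_zero (ENNReal.ofReal_pos.2 hc).ne', smul_eq_mul,
      ENNReal.ofReal_rpow_of_pos hc, abs_of_pos (by positivity), ← Real.rpow_natCast,
      ← Real.rpow_neg hr.le, ← Real.rpow_mul hr.le, one_div, ENNReal.toReal_inv]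

/-- Plancherel's theorem for the Fourier integral of a function in `L¹ ∩ L²`. -/
theorem eLpNorm_fourier_two_eq {V : Type*} [NormedAddCommGroup V] [InnerProductSpace ℝ V]
    [FiniteDimensional ℝ V] [MeasurableSpace V] [BorelSpace V] {h : V → ℂ}
    (h1 : Integrable h) (h2 : MemLp h 2) :
    eLpNorm (𝓕 h) 2 volume = eLpNorm h 2 volume := by
  have key : (𝓕 h : V → ℂ) =ᵐ[volume] (𝓕 (h2.toLp h) : Lp (α := V) ℂ 2 volume) := by
    have hcont : Continuous (𝓕 h) :=
      VectorFourier.fourierIntegral_continuous Real.continuous_fourierChar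
        (innerSL ℝ (E := V)).continuous₂ h1
    refine ae_eq_of_integral_contDiff_smul_eq (hcont.locallyIntegrable (μ := volume))
      ((Lp.memLp _).locallyIntegrable (by norm_num)) fun g hg hgs => ?_
    have hgs' : HasCompactSupport (fun x => (g x : ℂ)) := hgs.comp_left (g := Complex.ofReal) rfl
    let ψ : SchwartzMap V ℂ := hgs'.toSchwartzMap (Complex.ofRealCLM.contDiff.comp hg)
    have e1 := congrArg (fun T : TemperedDistribution V ℂ => T ψ)
      (MeasureTheory.Lp.fourier_toTemperedDistribution_eq (h2.toLp h))
    simp only [TemperedDistribution.fourier_apply, Lp.toTemperedDistribution_apply] at e1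
    have e2 := VectorFourier.integral_bilin_fourierIntegral_eq_flip (.mul ℂ ℂ) (L := innerₗ V)
      Real.continuous_fourierChar continuous_inner h1 (ψ.integrable (μ := volume))
    have hψ : ∀ x, ψ x = (g x : ℂ) := fun x => rfl
    rw [flip_innerₗ] at e2
    calc ∫ x, g x • 𝓕 h x = ∫ x, 𝓕 h x * ψ x := by
          refine integral_congr_ae (.of_forall fun x => ?_)
          simp only [hψ, Complex.real_smul, mul_comm]
      _ = ∫ x, h x * 𝓕 (ψ : V → ℂ) x := e2
      _ = ∫ x, (𝓕 ψ) x • (h2.toLp h) x := by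
          refine integral_congr_ae ?_
          filter_upwards [h2.coeFn_toLp] with x hx
          rw [hx, smul_eq_mul, mul_comm, SchwartzMap.fourier_coe]
      _ = _ := by
          rw [e1]
          refine integral_congr_ae (.of_forall fun x => ?_)
          simp only [hψ, Complex.real_smul, smul_eq_mul]
  rw [eLpNorm_congr_ae key, ← eLpNorm_congr_ae h2.coeFn_toLp, ← ENNReal.toReal_eq_toReal_iff'
    (Lp.eLpNorm_ne_top _) (Lp.eLpNorm_ne_top _), ← Lp.norm_def, ← Lp.norm_def,
    Lp.norm_fourier_eq]

/-- Hausdorff–Young for the exponents `q > 2` and `p = q / (q - 1)`, obtained by the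
Marcinkiewicz interpolation argument between `L¹ → L^∞` and `L² → L²`. -/
theorem lintegral_fourier_rpow_le {V : Type*} [NormedAddCommGroup V] [InnerProductSpace ℝ V]
    [FiniteDimensional ℝ V] [MeasurableSpace V] [BorelSpace V] {p q : ℝ} (hq : 2 < q)
    (hpq : (p - 1) * (q - 1) = 1) {h : V → ℂ} (hm : Measurable h)
    (h1 : Integrable h) (h2 : MemLp h 2) :
    ∫⁻ ξ, ‖𝓕 h ξ‖ₑ ^ q ≤
      ENNReal.ofReal (q * (4 * 2 ^ (q - 2) / (q - 2))) * (∫⁻ x, ‖h x‖ₑ ^ p) ^ (q - 1) := by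
  have hp1 : 0 < p - 1 := by
    by_contra hcon
    nlinarith
  have hC : 0 < q * (4 * 2 ^ (q - 2) / (q - 2)) := by
    have : 0 < q - 2 := by linarith
    positivity
  set N := ∫⁻ x, ‖h x‖ₑ ^ p with hN
  rcases eq_or_ne N ∞ with hNt | hNt
  · rw [hNt, ENNReal.top_rpow_of_pos (by linarith), ENNReal.mul_top (by simpa using hC)]
    exact le_top
  rcases eq_or_ne N 0 with hN0 | hN0
  · have h0 : h =ᵐ[volume] 0 := by
      rw [hN, lintegral_eq_zero_iff (hm.enorm.pow_const p)] at hN0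
      filter_upwards [hN0] with x hx
      simp only [Pi.zero_apply] at hx
      simpa using (ENNReal.rpow_eq_zero_iff_of_pos (by linarith)).1 hx
    have hF : 𝓕 h = 0 := by
      ext ξ
      rw [Real.fourier_congr_ae h0 ξ, Real.fourier_eq]
      simp
    simp [hF, ENNReal.zero_rpow_of_pos (by linarith : 0 < q)]
  set n := N.toReal with hn
  have hn0 : 0 < n := ENNReal.toReal_pos hN0 hNt
  have hNn : N = ENNReal.ofReal n := (ENNReal.ofReal_toReal hNt).symm
  have hcont : Continuous (𝓕 h) :=
    VectorFourier.fourierIntegral_continuous Real.continuous_fourierChar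
      (innerSL ℝ (E := V)).continuous₂ h1
  let G : V → ℝ → ℝ≥0∞ := fun x t =>
    if ‖h x‖ ≤ (2 * n / t) ^ (q - 1) then ENNReal.ofReal (4 * t ^ (q - 3)) * ‖h x‖ₑ ^ 2 else 0
  have hGm : Measurable (Function.uncurry G) := by
    refine Measurable.ite ?_ ?_ measurable_const
    · exact measurableSet_le (by fun_prop) (by fun_prop)
    · fun_prop
  have weak : ∀ t : ℝ, 0 < t →
      volume {ξ | t < ‖𝓕 h ξ‖} * ENNReal.ofReal (t ^ (q - 1)) ≤ ∫⁻ x, G x t := by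
    intro t ht
    set s := (2 * n / t) ^ (q - 1) with hs
    have hs0 : 0 < s := by positivity
    have hset : MeasurableSet {x | ‖h x‖ ≤ s} := measurableSet_le hm.norm measurable_const
    set hl := {x | ‖h x‖ ≤ s}.indicator h with hhl
    set hh := {x | ‖h x‖ ≤ s}ᶜ.indicator h with hhh
    have hl1 : Integrable hl := h1.indicator hset
    have hh1 : Integrable hh := h1.indicator hset.compl
    have hadd : ∀ ξ, 𝓕 h ξ = 𝓕 hl ξ + 𝓕 hh ξ := by
      intro ξ
      have := VectorFourier.fourierIntegral_add Real.continuous_fourierChar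
        (innerSL ℝ (E := V)).continuous₂ hl1 hh1
      have e : hl + hh = h := Set.indicator_self_add_compl _ _
      rw [e] at this
      exact congrFun this ξ
    have hsup : ∀ ξ, ‖𝓕 hh ξ‖ₑ ≤ ENNReal.ofReal (t / 2) := by
      intro ξ
      have hsp : s ^ (1 - p) * n = t / 2 := by
        rw [hs, ← Real.rpow_mul (by positivity), show (q - 1) * (1 - p) = -1 by linarith,
          Real.rpow_neg_one]
        field_simp
      calc ‖𝓕 hh ξ‖ₑ ≤ ∫⁻ x, ‖hh x‖ₑ := by
            rw [Real.fourier_eq]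
            refine (enorm_integral_le_lintegral_enorm _).trans_eq ?_
            refine lintegral_congr fun x => ?_
            rw [← ofReal_norm, Circle.norm_smul, ofReal_norm]
        _ ≤ ∫⁻ x, ENNReal.ofReal (s ^ (1 - p)) * ‖h x‖ₑ ^ p := by
            refine lintegral_mono fun x => ?_
            by_cases hx : ‖h x‖ ≤ s
            · simp [hhh, hx]
            · have hx' : x ∈ {x | ‖h x‖ ≤ s}ᶜ := hx
              push Not at hx
              have hx0 : 0 < ‖h x‖ := hs0.trans hx
              rw [hhh, Set.indicator_of_mem hx', ← ofReal_norm,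
                ENNReal.ofReal_rpow_of_pos hx0, ← ENNReal.ofReal_mul (by positivity)]
              refine ENNReal.ofReal_le_ofReal ?_
              calc ‖h x‖ = ‖h x‖ ^ (1 - p) * ‖h x‖ ^ p := by
                    rw [← Real.rpow_add hx0]; simp
                _ ≤ s ^ (1 - p) * ‖h x‖ ^ p := by
                    gcongr ?_ * _
                    exact Real.rpow_le_rpow_of_nonpos hs0 hx.le (by linarith)
        _ = ENNReal.ofReal (t / 2) := by
            rw [lintegral_const_mul _ (hm.enorm.pow_const p), ← hN, hNn,
              ← ENNReal.ofReal_mul (by positivity), hsp]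
    have hsub : {ξ | t < ‖𝓕 h ξ‖} ⊆ {ξ | ENNReal.ofReal (t / 2) ≤ ‖𝓕 hl ξ‖ₑ} := by
      intro ξ hξ
      simp only [Set.mem_ofPred_eq] at hξ ⊢
      rw [← ofReal_norm]
      refine ENNReal.ofReal_le_ofReal ?_
      have a1 : ‖𝓕 hh ξ‖ ≤ t / 2 := by
        have := hsup ξ
        rw [← ofReal_norm] at this
        exact (ENNReal.ofReal_le_ofReal_iff (by positivity)).1 this
      have a2 := norm_add_le (𝓕 hl ξ) (𝓕 hh ξ)
      rw [← hadd] at a2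
      linarith
    have hl2 : MemLp hl 2 := h2.indicator hset
    have cheb := mul_meas_ge_le_pow_eLpNorm' (μ := volume) (p := 2) (by norm_num) (by norm_num)
      (f := 𝓕 hl) (VectorFourier.fourierIntegral_continuous Real.continuous_fourierChar
        (innerSL ℝ (E := V)).continuous₂ hl1).aestronglyMeasurable (ENNReal.ofReal (t / 2))
    rw [eLpNorm_fourier_two_eq hl1 hl2] at cheb
    have e2 : eLpNorm hl 2 volume ^ (2 : ℝ≥0∞).toReal = ∫⁻ x, ‖hl x‖ₑ ^ 2 := by
      rw [eLpNorm_eq_lintegral_rpow_enorm_toReal (by norm_num) (by norm_num)]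
      rw [← ENNReal.rpow_mul]
      simp
    rw [e2] at cheb
    calc volume {ξ | t < ‖𝓕 h ξ‖} * ENNReal.ofReal (t ^ (q - 1))
        ≤ volume {ξ | ENNReal.ofReal (t / 2) ≤ ‖𝓕 hl ξ‖ₑ} * ENNReal.ofReal (t ^ (q - 1)) := by
          gcongr
      _ = ENNReal.ofReal (4 * t ^ (q - 3)) * (ENNReal.ofReal (t / 2) ^ (2 : ℝ≥0∞).toReal *
            volume {ξ | ENNReal.ofReal (t / 2) ≤ ‖𝓕 hl ξ‖ₑ}) := by
          rw [← mul_assoc, ENNReal.ofReal_rpow_of_pos (by positivity),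
            ← ENNReal.ofReal_mul (by positivity), mul_comm]
          congr 2
          rw [show q - 1 = q - 3 + 2 by ring, Real.rpow_add ht]
          simp
          ring
      _ ≤ ENNReal.ofReal (4 * t ^ (q - 3)) * ∫⁻ x, ‖hl x‖ₑ ^ 2 := by gcongr
      _ = ∫⁻ x, G x t := by
          rw [← lintegral_const_mul _ ((hm.indicator hset).enorm.pow_const 2)]
          refine lintegral_congr fun x => ?_
          by_cases hx : ‖h x‖ ≤ s
          · simp [G, ← hs, hx]
          · simp [G, ← hs, hx]
  have inner : ∀ x, ∫⁻ t in Set.Ioi (0 : ℝ), G x t ≤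
      ENNReal.ofReal (4 * (2 * n) ^ (q - 2) / (q - 2)) * ‖h x‖ₑ ^ p := by
    intro x
    rcases eq_or_ne (h x) 0 with hx | hx
    · simp [G, hx]
    have hx0 : 0 < ‖h x‖ := norm_pos_iff.2 hx
    set T := 2 * n * ‖h x‖ ^ (-(p - 1)) with hT
    have hT0 : 0 < T := by positivity
    have hle : ∀ t ∈ Set.Ioi (0 : ℝ), G x t ≤
        (Set.Ioc 0 T).indicator (fun t => ENNReal.ofReal (‖h x‖ ^ 2 * 4 * t ^ (q - 3))) t := by
      intro t ht
      have ht : 0 < t := ht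
      by_cases hxt : ‖h x‖ ≤ (2 * n / t) ^ (q - 1)
      · have htT : t ≤ T := by
          have := Real.rpow_le_rpow hx0.le hxt hp1.le
          rw [← Real.rpow_mul (by positivity), mul_comm (q - 1), hpq, Real.rpow_one,
            le_div_iff₀ ht] at this
          rw [hT, Real.rpow_neg hx0.le, ← div_eq_mul_inv, le_div_iff₀ (by positivity)]
          linarith
        rw [Set.indicator_of_mem (show t ∈ Set.Ioc 0 T from ⟨ht, htT⟩)]
        simp only [G, if_pos hxt]
        rw [← ofReal_norm, ← ENNReal.ofReal_pow hx0.le, ← ENNReal.ofReal_mul (by positivity)]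
        refine ENNReal.ofReal_le_ofReal (le_of_eq (by ring))
      · simp [G, if_neg hxt]
    calc ∫⁻ t in Set.Ioi (0 : ℝ), G x t
        ≤ ∫⁻ t in Set.Ioi (0 : ℝ), (Set.Ioc 0 T).indicator
            (fun t => ENNReal.ofReal (‖h x‖ ^ 2 * 4 * t ^ (q - 3))) t :=
          setLIntegral_mono' measurableSet_Ioi hle
      _ ≤ ∫⁻ t in Set.Ioc 0 T, ENNReal.ofReal (‖h x‖ ^ 2 * 4 * t ^ (q - 3)) := by
          rw [← lintegral_indicator measurableSet_Ioc]
          exact setLIntegral_le_lintegral _ _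
      _ = ENNReal.ofReal (∫ t in Set.Ioc 0 T, ‖h x‖ ^ 2 * 4 * t ^ (q - 3)) := by
          rw [ofReal_integral_eq_lintegral_ofReal]
          · exact ((intervalIntegrable_iff_integrableOn_Ioc_of_le hT0.le).1
              (intervalIntegral.intervalIntegrable_rpow' (by linarith))).const_mul _
          · filter_upwards [ae_restrict_mem measurableSet_Ioc] with t ht
            have := ht.1
            positivity
      _ = ENNReal.ofReal (4 * (2 * n) ^ (q - 2) / (q - 2)) * ‖h x‖ₑ ^ p := by
          rw [← intervalIntegral.integral_of_le hT0.le, intervalIntegral.integral_const_mul,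
            integral_rpow (Or.inl (by linarith)), ← ofReal_norm, ENNReal.ofReal_rpow_of_pos hx0,
            ← ENNReal.ofReal_mul (by have : 0 < q - 2 := by linarith
                                     positivity)]
          congr 1
          rw [show q - 3 + 1 = q - 2 by ring, Real.zero_rpow (by linarith), hT,
            Real.mul_rpow (by positivity) (by positivity), ← Real.rpow_mul hx0.le,
            show p = 2 + -(p - 1) * (q - 2) by linarith, Real.rpow_add hx0,
            show 2 + -(p - 1) * (q - 2) = p by linarith]
          simp
          ring
  have hGe : ∫⁻ ξ, ‖𝓕 h ξ‖ₑ ^ q = ENNReal.ofReal q *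
      ∫⁻ t in Set.Ioi (0 : ℝ), volume {ξ | t < ‖𝓕 h ξ‖} * ENNReal.ofReal (t ^ (q - 1)) := by
    rw [← lintegral_rpow_eq_lintegral_meas_lt_mul volume (.of_forall fun _ => norm_nonneg _)
      hcont.norm.measurable.aemeasurable (by linarith)]
    refine lintegral_congr fun ξ => ?_
    rw [← ofReal_norm, ENNReal.ofReal_rpow_of_nonneg (norm_nonneg _) (by linarith)]
  calc ∫⁻ ξ, ‖𝓕 h ξ‖ₑ ^ q ≤ ENNReal.ofReal q * ∫⁻ t in Set.Ioi (0 : ℝ), ∫⁻ x, G x t := by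
        rw [hGe]
        refine mul_le_mul_right ?_ _
        exact setLIntegral_mono' measurableSet_Ioi fun t ht => weak t ht
    _ = ENNReal.ofReal q * ∫⁻ x, ∫⁻ t in Set.Ioi (0 : ℝ), G x t := by
        rw [lintegral_lintegral_swap]
        exact (hGm.comp measurable_swap).aemeasurable
    _ ≤ ENNReal.ofReal q * ∫⁻ x, ENNReal.ofReal (4 * (2 * n) ^ (q - 2) / (q - 2)) * ‖h x‖ₑ ^ p := by
        gcongr with x
        exact inner x
    _ = _ := by
        rw [lintegral_const_mul _ (hm.enorm.pow_const p), ← hN, hNn,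
          ENNReal.ofReal_rpow_of_pos hn0, ← ENNReal.ofReal_mul (by
            have : 0 < q - 2 := by linarith
            positivity), ← ENNReal.ofReal_mul (by linarith), ← ENNReal.ofReal_mul hC.le]
        congr 1
        rw [Real.mul_rpow (by norm_num) hn0.le, show q - 1 = (q - 2) + 1 by ring,
          Real.rpow_add hn0, Real.rpow_one]
        ring

theorem SchwartzMap.eLpNorm_fourier_two {V : Type*} [NormedAddCommGroup V]
    [InnerProductSpace ℝ V] [FiniteDimensional ℝ V] [MeasurableSpace V] [BorelSpace V]
    (g : SchwartzMap V ℂ) : eLpNorm (𝓕 (g : V → ℂ)) 2 volume = eLpNorm g 2 volume :=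
  eLpNorm_fourier_two_eq g.integrable (g.memLp 2)

theorem SchwartzMap.exists_eLpNorm_le_eLpNorm_fourier {V : Type*} [NormedAddCommGroup V]
    [InnerProductSpace ℝ V] [FiniteDimensional ℝ V] [MeasurableSpace V] [BorelSpace V]
    {q q' : ℝ≥0∞} (hq : 2 ≤ q) (hqt : q ≠ ∞) (hconj : 1 / q + 1 / q' = 1) :
    ∃ C : ℝ≥0∞, C ≠ ∞ ∧ ∀ g : SchwartzMap V ℂ,
      eLpNorm g q volume ≤ C * eLpNorm (𝓕 (g : V → ℂ)) q' volume := by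
  simp only [one_div] at hconj
  have hq0 : q ≠ 0 := by rintro rfl; simp at hq
  rcases hq.eq_or_lt with rfl | hq2
  · have : q' = 2 := by
      have h2 := hconj.trans ENNReal.inv_two_add_inv_two.symm
      exact inv_inj.1 ((ENNReal.add_right_inj (by simp)).1 h2)
    subst this
    exact ⟨1, by simp, fun g => by rw [one_mul, g.eLpNorm_fourier_two]⟩
  have hrq : 2 < q.toReal := by
    simpa using (ENNReal.toReal_lt_toReal (by simp) hqt).2 hq2
  have hq'0 : q' ≠ 0 := by rintro rfl; simp at hconj
  have hq't : q' ≠ ∞ := by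
    rintro rfl
    simp only [ENNReal.inv_top, add_zero, ENNReal.inv_eq_one] at hconj
    rw [hconj] at hq2
    norm_num at hq2
  have hr : q.toReal⁻¹ + q'.toReal⁻¹ = 1 := by
    have := congrArg ENNReal.toReal hconj
    rwa [ENNReal.toReal_add (by simpa) (by simpa), ENNReal.toReal_inv, ENNReal.toReal_inv,
      ENNReal.toReal_one] at this
  set a := q.toReal
  set b := q'.toReal
  have hb0 : 0 < b := ENNReal.toReal_pos hq'0 hq't
  have ha0 : 0 < a := by linarith
  have hab : a + b = a * b := by
    field_simp at hr
    linarith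
  have hpq : (b - 1) * (a - 1) = 1 := by linarith
  refine ⟨ENNReal.ofReal (a * (4 * 2 ^ (a - 2) / (a - 2))) ^ (1 / a), ?_, fun g => ?_⟩
  · exact ENNReal.rpow_ne_top_of_nonneg (by positivity) ENNReal.ofReal_ne_top
  have hinv : ∀ x, g x = 𝓕 (𝓕 (g : V → ℂ)) (-x) := by
    intro x
    rw [← Real.fourierInv_eq_fourier_neg, ← SchwartzMap.fourier_coe, ← SchwartzMap.fourierInv_coe,
      FourierTransform.fourierInv_fourier_eq]
  have key := lintegral_fourier_rpow_le hrq hpq (h := 𝓕 (g : V → ℂ))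
    (by rw [← SchwartzMap.fourier_coe]; exact (𝓕 g).continuous.measurable)
    (by rw [← SchwartzMap.fourier_coe]; exact (𝓕 g).integrable)
    (by rw [← SchwartzMap.fourier_coe]; exact (𝓕 g).memLp 2)
  have e1 : ∫⁻ x, ‖g x‖ₑ ^ a = ∫⁻ x, ‖𝓕 (𝓕 (g : V → ℂ)) x‖ₑ ^ a := by
    rw [← lintegral_neg_eq_self]
    exact lintegral_congr fun x => by rw [hinv, neg_neg]
  rw [eLpNorm_eq_lintegral_rpow_enorm_toReal hq0 hqt,
    eLpNorm_eq_lintegral_rpow_enorm_toReal hq'0 hq't, e1]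
  calc _ ≤ _ := ENNReal.rpow_le_rpow key (by positivity)
    _ = _ := by
      have h2 : (a - 1) * (1 / a) = 1 / b := by
        field_simp
        linarith
      rw [ENNReal.mul_rpow_of_nonneg _ _ (by positivity), ← ENNReal.rpow_mul, h2]

/-- Local `L^q` control of the high frequencies by a weighted `L^{q'}` norm. -/
theorem SchwartzMap.exists_eLpNorm_restrict_le_of_fourier_le {V : Type*} [NormedAddCommGroup V]
    [InnerProductSpace ℝ V] [FiniteDimensional ℝ V] [MeasurableSpace V] [BorelSpace V]
    {q q' : ℝ≥0∞} (hq : 1 ≤ q) (hqt : q ≠ ∞) (hconj : 1 / q + 1 / q' = 1) {β : ℝ} (hβ : 0 < β)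
    (hcond : q < 2 → (Module.finrank ℝ V : ℝ) * ((1 / q).toReal - 1 / 2) < β)
    {B : Set V} (hB : volume B ≠ ∞) :
    ∃ C : ℝ≥0∞, C ≠ ∞ ∧ ∀ f g : SchwartzMap V ℂ,
      (∀ ξ, ‖𝓕 (g : V → ℂ) ξ‖ ≤ ‖𝓕 (f : V → ℂ) ξ‖) →
      (∀ ξ, ‖ξ‖ < 1 → 𝓕 (g : V → ℂ) ξ = 0) →
      eLpNorm g q (volume.restrict B) ≤
        C * eLpNorm (fun ξ => ‖ξ‖ ^ β * ‖𝓕 (f : V → ℂ) ξ‖) q' volume := by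
  rcases le_or_gt 2 q with hq2 | hq2
  · obtain ⟨C, hC, h⟩ := exists_eLpNorm_le_eLpNorm_fourier (V := V) hq2 hqt hconj
    refine ⟨C, hC, fun f g hg hg0 => (eLpNorm_mono_measure _ Measure.restrict_le_self).trans
      ((h g).trans ?_)⟩
    gcongr
    refine eLpNorm_mono_real fun ξ => ?_
    rcases lt_or_ge ‖ξ‖ 1 with h1 | h1
    · rw [hg0 ξ h1, norm_zero]
      positivity
    · exact (hg ξ).trans (le_mul_of_one_le_left (norm_nonneg _) (Real.one_le_rpow h1 hβ.le))
  have hcond := hcond hq2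
  simp only [one_div] at hconj hcond
  have hq0 : q ≠ 0 := by rintro rfl; simp at hq
  set σ := q⁻¹.toReal - 2⁻¹ with hσ
  have hqinv : q⁻¹ ≠ ∞ := by simpa
  have hσ0 : 0 < σ := by
    have : (2 : ℝ≥0∞)⁻¹ < q⁻¹ := ENNReal.inv_lt_inv.2 hq2
    have := (ENNReal.toReal_lt_toReal (by simp) hqinv).2 this
    rw [ENNReal.toReal_inv] at this
    simp only [ENNReal.toReal_ofNat] at this
    linarith
  set s : ℝ≥0∞ := ENNReal.ofReal σ⁻¹ with hs
  have hs0 : s ≠ 0 := by simpa [hs] using hσ0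
  have hsr : s.toReal = σ⁻¹ := ENNReal.toReal_ofReal (by positivity)
  have hq'inv : q'⁻¹ ≠ ∞ := fun h => by rw [h] at hconj; simp at hconj
  have hol : ENNReal.HolderTriple s q' 2 := by
    constructor
    rw [← ENNReal.toReal_eq_toReal_iff' (by simpa using ⟨hs0, fun h => hq'inv (by simp [h])⟩)
      (by simp), ENNReal.toReal_add (by simpa) hq'inv]
    have := congrArg ENNReal.toReal hconj
    rw [ENNReal.toReal_add hqinv hq'inv, ENNReal.toReal_one] at this
    rw [ENNReal.toReal_inv s, hsr, inv_inv, ENNReal.toReal_inv 2, ENNReal.toReal_ofNat]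
    linarith
  let w : V → ℝ := fun ξ => (1 + ‖ξ‖) ^ (-β)
  have hw : MemLp w s volume := by
    have hc : Continuous w := by
      refine (continuous_const.add continuous_norm).rpow_const fun ξ => Or.inl ?_
      have h0 : 0 < 1 + ‖ξ‖ := by positivity
      exact h0.ne'
    rw [← integrable_norm_rpow_iff hc.aestronglyMeasurable hs0 ENNReal.ofReal_ne_top]
    have : Integrable (fun ξ : V => (1 + ‖ξ‖) ^ (-(β * σ⁻¹))) :=
      integrable_one_add_norm (by rwa [← div_eq_mul_inv, lt_div_iff₀ hσ0])
    refine this.congr (.of_forall fun ξ => ?_)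
    have h0 : 0 < 1 + ‖ξ‖ := by positivity
    simp only [w, hsr]
    rw [Real.norm_of_nonneg (by positivity), ← Real.rpow_mul h0.le]
    ring_nf
  refine ⟨ENNReal.ofReal (2 ^ β) * eLpNorm w s volume * volume B ^ σ, ?_, fun f g hg hg0 => ?_⟩
  · exact ENNReal.mul_ne_top (ENNReal.mul_ne_top ENNReal.ofReal_ne_top hw.eLpNorm_ne_top)
      (ENNReal.rpow_ne_top_of_nonneg hσ0.le hB)
  have hF : Continuous (𝓕 (f : V → ℂ)) := by
    rw [← SchwartzMap.fourier_coe]; exact (𝓕 f).continuous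
  calc eLpNorm g q (volume.restrict B)
      ≤ eLpNorm g 2 (volume.restrict B) * volume B ^ σ := by
        have := eLpNorm_le_eLpNorm_mul_rpow_measure_univ (μ := volume.restrict B) hq2.le
          (f := g) g.continuous.aestronglyMeasurable
        simpa [hσ] using this
    _ ≤ eLpNorm g 2 volume * volume B ^ σ := by
        gcongr
        exact Measure.restrict_le_self
    _ = eLpNorm (𝓕 (g : V → ℂ)) 2 volume * volume B ^ σ := by rw [g.eLpNorm_fourier_two]
    _ ≤ (ENNReal.ofReal (2 ^ β) *
          eLpNorm (w • fun ξ => ‖ξ‖ ^ β * ‖𝓕 (f : V → ℂ) ξ‖) 2 volume) * volume B ^ σ := by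
        gcongr
        refine eLpNorm_le_mul_eLpNorm_of_ae_le_mul (.of_forall fun ξ => ?_) 2
        simp only [w, Pi.smul_apply', smul_eq_mul]
        rw [Real.norm_of_nonneg (by positivity)]
        rcases lt_or_ge ‖ξ‖ 1 with h1 | h1
        · rw [hg0 ξ h1, norm_zero]
          positivity
        · have h0 : 0 < 1 + ‖ξ‖ := by positivity
          have h2 : 1 ≤ 2 ^ β * ((1 + ‖ξ‖) ^ (-β) * ‖ξ‖ ^ β) := by
            rw [Real.rpow_neg h0.le, ← mul_assoc, mul_right_comm, ← Real.mul_rpow (by norm_num)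
              (norm_nonneg _), ← div_eq_mul_inv, ← Real.div_rpow (by positivity) h0.le]
            refine Real.one_le_rpow ?_ hβ.le
            rw [one_le_div h0]
            linarith
          calc ‖𝓕 (g : V → ℂ) ξ‖ ≤ 1 * ‖𝓕 (f : V → ℂ) ξ‖ := by simpa using hg ξ
            _ ≤ _ := mul_le_mul_of_nonneg_right h2 (norm_nonneg _)
            _ = _ := by ring
    _ ≤ (ENNReal.ofReal (2 ^ β) * (eLpNorm w s volume *
          eLpNorm (fun ξ => ‖ξ‖ ^ β * ‖𝓕 (f : V → ℂ) ξ‖) q' volume)) * volume B ^ σ := by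
        gcongr
        refine eLpNorm_smul_le_mul_eLpNorm ?_ hw.aestronglyMeasurable
        exact (((continuous_norm.rpow_const fun _ => Or.inr hβ.le).mul
          hF.norm)).aestronglyMeasurable
    _ = _ := by ring

theorem SchwartzMap.enorm_convolution_le {V : Type*} [NormedAddCommGroup V]
    [InnerProductSpace ℝ V] [FiniteDimensional ℝ V] [MeasurableSpace V] [BorelSpace V]
    {q q' : ℝ≥0∞} (hconj : 1 / q + 1 / q' = 1) (k f : SchwartzMap V ℂ) (x : V) :
    ‖SchwartzMap.convolution (.mul ℂ ℂ) k f x‖ₑ ≤ eLpNorm k q' volume * eLpNorm f q volume := by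
  have hol : ENNReal.HolderTriple q' q 1 := ⟨by simpa [add_comm] using hconj⟩
  have hsub : eLpNorm (fun t => f (x - t)) q volume = eLpNorm f q volume :=
    eLpNorm_comp_measurePreserving f.continuous.aestronglyMeasurable
      (Measure.measurePreserving_sub_left volume x)
  rw [SchwartzMap.convolution_apply, ← hsub]
  calc ‖∫ t, k t * f (x - t)‖ₑ ≤ ∫⁻ t, ‖k t * f (x - t)‖ₑ := enorm_integral_le_lintegral_enorm _
    _ = eLpNorm (⇑k • fun t => f (x - t)) 1 volume := by
      rw [eLpNorm_one_eq_lintegral_enorm]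
      rfl
    _ ≤ _ := eLpNorm_smul_le_mul_eLpNorm (by
        have : Continuous fun t => f (x - t) := f.continuous.comp (by fun_prop)
        exact this.aestronglyMeasurable) k.continuous.aestronglyMeasurable

theorem tendsto_volume_ball_zero (V : Type*) [NormedAddCommGroup V]
    [InnerProductSpace ℝ V] [FiniteDimensional ℝ V] [MeasurableSpace V] [BorelSpace V]
    [Nontrivial V] :
    Filter.Tendsto (fun R : ℝ => volume (Metric.ball (0 : V) R)) (nhdsWithin 0 (Set.Ioi 0))
      (nhds 0) := by
  have hc : Continuous fun R : ℝ => ENNReal.ofReal (R ^ Module.finrank ℝ V) :=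
    ENNReal.continuous_ofReal.comp (continuous_pow _)
  have h1 := ENNReal.Tendsto.mul_const (b := volume (Metric.ball (0 : V) 1)) (hc.tendsto 0)
    (Or.inr measure_ball_lt_top.ne)
  simp only [zero_pow (Module.finrank_pos (R := ℝ) (M := V)).ne', ENNReal.ofReal_zero,
    zero_mul] at h1
  refine (h1.mono_left nhdsWithin_le_nhds).congr' ?_
  filter_upwards [self_mem_nhdsWithin] with R hR
  exact (Measure.addHaar_ball _ _ (le_of_lt hR)).symm

theorem exists_fourier_eq_cutoff (V : Type*) [NormedAddCommGroup V]
    [InnerProductSpace ℝ V] [FiniteDimensional ℝ V] [MeasurableSpace V] [BorelSpace V] :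
    ∃ (k : SchwartzMap V ℂ) (b : V → ℝ), (∀ ξ, 𝓕 k ξ = b ξ) ∧ (∀ ξ, 0 ≤ b ξ) ∧
      (∀ ξ, b ξ ≤ 1) ∧ ∀ ξ, ‖ξ‖ < 1 → b ξ = 1 := by
  let b : ContDiffBump (0 : V) := ⟨1, 2, one_pos, one_lt_two⟩
  have hbs : HasCompactSupport fun ξ => (b ξ : ℂ) :=
    b.hasCompactSupport.comp_left (g := Complex.ofReal) Complex.ofReal_zero
  have hbc : ContDiff ℝ (⊤ : ℕ∞) fun ξ => (b ξ : ℂ) := Complex.ofRealCLM.contDiff.comp b.contDiff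
  refine ⟨𝓕⁻ (hbs.toSchwartzMap hbc), b, fun ξ => ?_, fun ξ => b.nonneg, fun ξ => b.le_one,
    fun ξ hξ => b.one_of_mem_closedBall (by simpa using hξ.le)⟩
  rw [FourierTransform.fourier_fourierInv_eq]
  rfl

set_option maxHeartbeats 1000000 in
theorem SchwartzMap.exists_eLpNorm_le_add {V : Type*} [NormedAddCommGroup V]
    [InnerProductSpace ℝ V] [FiniteDimensional ℝ V] [MeasurableSpace V] [BorelSpace V]
    [Nontrivial V]
    {q q' : ℝ≥0∞} (hq : 1 ≤ q) (hqt : q ≠ ∞) (hconj : 1 / q + 1 / q' = 1)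
    {α β : ℝ} (hα : 0 < α) (hβ : 0 < β)
    (hcond : q < 2 → (Module.finrank ℝ V : ℝ) * ((1 / q).toReal - 1 / 2) < β) :
    ∃ C : ℝ≥0∞, C ≠ ∞ ∧ ∀ f : SchwartzMap V ℂ,
      eLpNorm f q volume ≤ C * (eLpNorm (fun x => ‖x‖ ^ α * ‖f x‖) q volume +
        eLpNorm (fun ξ => ‖ξ‖ ^ β * ‖𝓕 (f : V → ℂ) ξ‖) q' volume) := by
  have hq0 : q ≠ 0 := by rintro rfl; simp at hq
  have hqr : 0 < q.toReal := ENNReal.toReal_pos hq0 hqt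
  obtain ⟨k, b, hk, hb0, hb1, hb⟩ := exists_fourier_eq_cutoff V
  obtain ⟨R, hR, hRk⟩ : ∃ R : ℝ, 0 < R ∧
      eLpNorm k q' volume * volume (Metric.ball (0 : V) R) ^ q.toReal⁻¹ ≤ 2⁻¹ := by
    have hk : eLpNorm k q' volume ≠ ∞ := (k.memLp q' volume).eLpNorm_ne_top
    have ht := ENNReal.Tendsto.const_mul (a := eLpNorm k q' volume)
      ((tendsto_volume_ball_zero V).ennrpow_const q.toReal⁻¹) (Or.inr hk)
    rw [ENNReal.zero_rpow_of_pos (by positivity), mul_zero] at ht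
    obtain ⟨R, h1, hR⟩ := ((ht.eventually_le_const (by simp : (0 : ℝ≥0∞) < 2⁻¹)).and
      self_mem_nhdsWithin).exists
    exact ⟨R, hR, h1⟩
  set B := Metric.ball (0 : V) R with hB
  have hBm : MeasurableSet B := measurableSet_ball
  obtain ⟨C, hC, hg⟩ := exists_eLpNorm_restrict_le_of_fourier_le hq hqt hconj hβ hcond
    (B := B) measure_ball_lt_top.ne
  refine ⟨2 * (ENNReal.ofReal (R ^ (-α)) + C), ENNReal.mul_ne_top (by simp)
    (ENNReal.add_ne_top.2 ⟨ENNReal.ofReal_ne_top, hC⟩), fun f => ?_⟩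
  set X := eLpNorm (fun x => ‖x‖ ^ α * ‖f x‖) q volume
  set Y := eLpNorm (fun ξ => ‖ξ‖ ^ β * ‖𝓕 (f : V → ℂ) ξ‖) q' volume
  set h := SchwartzMap.convolution (.mul ℂ ℂ) k f with hh
  have hFh : ∀ ξ, 𝓕 (f - h) ξ = (1 - (b ξ : ℂ)) * 𝓕 f ξ := fun ξ => by
    have h1 : 𝓕 h = SchwartzMap.pairing (.mul ℂ ℂ) (𝓕 k) (𝓕 f) := by
      rw [hh, SchwartzMap.fourier_convolution]
    have h2 : 𝓕 (f - h) = 𝓕 f - 𝓕 h := sub_eq_add_neg f h ▸ by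
      rw [FourierTransform.fourier_add, FourierTransform.fourier_neg, sub_eq_add_neg]
    rw [h2, h1]
    change 𝓕 f ξ - 𝓕 k ξ * 𝓕 f ξ = _
    rw [hk]
    ring
  have hgY : eLpNorm (f - h) q (volume.restrict B) ≤ C * Y := by
    refine hg f (f - h) (fun ξ => ?_) fun ξ hξ => ?_
    · rw [← SchwartzMap.fourier_coe, ← SchwartzMap.fourier_coe, hFh, norm_mul]
      refine mul_le_of_le_one_left (norm_nonneg _) ?_
      rw [← Complex.ofReal_one, ← Complex.ofReal_sub, Complex.norm_real, Real.norm_of_nonneg]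
      · linarith [hb0 ξ]
      · linarith [hb1 ξ]
    · rw [← SchwartzMap.fourier_coe, hFh, hb ξ hξ]
      simp
  have hhF : eLpNorm h q (volume.restrict B) ≤ 2⁻¹ * eLpNorm f q volume := by
    calc eLpNorm h q (volume.restrict B) ≤
        eLpNorm (fun _ : V => eLpNorm k q' volume * eLpNorm f q volume) q (volume.restrict B) :=
          eLpNorm_mono_enorm fun x => by
            simpa using SchwartzMap.enorm_convolution_le hconj k f x
      _ = (eLpNorm k q' volume * volume B ^ q.toReal⁻¹) * eLpNorm f q volume := by
          rw [eLpNorm_const' _ hq0 hqt]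
          simp
          ring
      _ ≤ _ := by gcongr
  have hout : eLpNorm f q (volume.restrict Bᶜ) ≤ ENNReal.ofReal (R ^ (-α)) * X := by
    refine (eLpNorm_le_mul_eLpNorm_of_ae_le_mul (g := fun x => ‖x‖ ^ α * ‖f x‖)
      (c := R ^ (-α)) ?_ q).trans ?_
    · filter_upwards [ae_restrict_mem hBm.compl] with x hx
      have hx : R ≤ ‖x‖ := by simpa [hB] using hx
      rw [Real.norm_of_nonneg (by positivity), ← mul_assoc]
      refine le_mul_of_one_le_left (norm_nonneg _) ?_
      rw [Real.rpow_neg hR.le, inv_mul_eq_div, one_le_div (by positivity)]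
      exact Real.rpow_le_rpow hR.le hx hα.le
    · gcongr
      exact eLpNorm_mono_measure _ Measure.restrict_le_self
  have hsplit : eLpNorm f q volume ≤
      eLpNorm f q (volume.restrict B) + eLpNorm f q (volume.restrict Bᶜ) := by
    have := eLpNorm_add_le (μ := volume) (p := q)
      (f.continuous.aestronglyMeasurable.indicator hBm)
      (f.continuous.aestronglyMeasurable.indicator hBm.compl) hq
    rwa [Set.indicator_self_add_compl, eLpNorm_indicator_eq_eLpNorm_restrict hBm,
      eLpNorm_indicator_eq_eLpNorm_restrict hBm.compl] at this
  have hin : eLpNorm f q (volume.restrict B) ≤ C * Y + 2⁻¹ * eLpNorm f q volume := by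
    have := eLpNorm_add_le (μ := volume.restrict B) (p := q)
      (f - h).continuous.aestronglyMeasurable h.continuous.aestronglyMeasurable hq
    have he : (⇑(f - h) + ⇑h) = ⇑f := by ext; simp
    rw [he] at this
    exact this.trans (add_le_add hgY hhF)
  have hF : eLpNorm f q volume ≠ ∞ := (f.memLp q volume).eLpNorm_ne_top
  set F := eLpNorm f q volume
  set D := ENNReal.ofReal (R ^ (-α))
  have htot : F ≤ (D + C) * (X + Y) + 2⁻¹ * F := by
    calc F ≤ (C * Y + 2⁻¹ * F) + D * X := hsplit.trans (add_le_add hin hout)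
      _ ≤ (C * Y + 2⁻¹ * F) + D * X + (D * Y + C * X) := le_self_add
      _ = _ := by ring
  have hhalf : 2⁻¹ * F + 2⁻¹ * F = F := by
    rw [← add_mul, ENNReal.inv_two_add_inv_two, one_mul]
  have : 2⁻¹ * F ≤ (D + C) * (X + Y) := by
    refine (ENNReal.add_le_add_iff_right (a := 2⁻¹ * F) ?_).1 (by rwa [hhalf])
    exact ENNReal.mul_ne_top (by simp) hF
  calc F = 2 * (2⁻¹ * F) := by
        rw [← mul_assoc, ENNReal.mul_inv_cancel (by simp) (by simp), one_mul]
    _ ≤ 2 * ((D + C) * (X + Y)) := by gcongr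
    _ = _ := by ring

theorem eLpNorm_rpow_norm_mul_comp_smul {E F : Type*} [NormedAddCommGroup E] [NormedSpace ℝ E]
    [FiniteDimensional ℝ E] [MeasurableSpace E] [BorelSpace E] [NormedAddCommGroup F]
    (μ : Measure E) [μ.IsAddHaarMeasure] (h : E → F) (p : ℝ≥0∞) {r : ℝ} (hr : 0 < r) (α : ℝ) :
    eLpNorm (fun x => ‖x‖ ^ α * ‖h (r • x)‖) p μ =
      ENNReal.ofReal (r ^ (-α - (Module.finrank ℝ E : ℝ) * p⁻¹.toReal)) *
        eLpNorm (fun x => ‖x‖ ^ α * ‖h x‖) p μ := by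
  have h1 : (fun x => ‖x‖ ^ α * ‖h (r • x)‖) =
      fun x => (r ^ (-α) • fun y => ‖y‖ ^ α * ‖h y‖) (r • x) := by
    ext x
    have h2 : r ^ (-α) * r ^ α = 1 := by rw [← Real.rpow_add hr]; simp
    simp only [Pi.smul_apply, smul_eq_mul, norm_smul, Real.norm_of_nonneg hr.le]
    rw [Real.mul_rpow hr.le (norm_nonneg _)]
    linear_combination (-‖x‖ ^ α * ‖h (r • x)‖) * h2
  rw [h1, eLpNorm_comp_smul_eq μ _ p hr, eLpNorm_const_smul, ← mul_assoc]
  congr 1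
  rw [Real.enorm_of_nonneg (by positivity), ← ENNReal.ofReal_mul (by positivity),
    ← Real.rpow_add hr]
  ring_nf

theorem Real.fourier_comp_smul {V : Type*} [NormedAddCommGroup V]
    [InnerProductSpace ℝ V] [FiniteDimensional ℝ V] [MeasurableSpace V] [BorelSpace V]
    (f : V → ℂ) {r : ℝ} (hr : 0 < r) (ξ : V) :
    𝓕 (fun x => f (r • x)) ξ = (r ^ (-(Module.finrank ℝ V : ℝ)) : ℝ) • 𝓕 f (r⁻¹ • ξ) := by
  have := Measure.integral_comp_smul volume
    (fun y => Real.fourierChar (-(inner ℝ y (r⁻¹ • ξ))) • f y) r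
  rw [Real.fourier_eq, Real.fourier_eq]
  simp only [inner_smul_left, inner_smul_right] at this ⊢
  rw [abs_of_nonneg (by positivity)] at this
  rw [Real.rpow_neg hr.le, Real.rpow_natCast, ← this]
  congr 1
  ext x
  simp [hr.ne']

theorem ENNReal.le_rpow_mul_rpow_of_forall_le {F X Y C : ℝ≥0∞} {α β : ℝ} (hα : 0 < α)
    (hβ : 0 < β) (hC : C ≠ 0) (hX : X = 0 → F = 0) (hY : Y = 0 → F = 0)
    (h : ∀ r : ℝ, 0 < r → F ≤ C * (ENNReal.ofReal (r ^ (-α)) * X + ENNReal.ofReal (r ^ β) * Y)) :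
    F ≤ 2 * C * (X ^ (β / (α + β)) * Y ^ (α / (α + β))) := by
  have hs : 0 < α + β := by positivity
  have ha : 0 < α / (α + β) := by positivity
  have hb : 0 < β / (α + β) := by positivity
  rcases eq_or_ne X 0 with hX0 | hX0
  · simp [hX hX0]
  rcases eq_or_ne Y 0 with hY0 | hY0
  · simp [hY hY0]
  rcases eq_or_ne X ∞ with rfl | hXt
  · rw [ENNReal.top_rpow_of_pos hb, ENNReal.top_mul, ENNReal.mul_top (by simpa)]
    · exact le_top
    · simp [ENNReal.rpow_eq_zero_iff, hY0, ha.le]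
  rcases eq_or_ne Y ∞ with rfl | hYt
  · rw [ENNReal.top_rpow_of_pos ha, ENNReal.mul_top, ENNReal.mul_top (by simpa)]
    · exact le_top
    · simp [ENNReal.rpow_eq_zero_iff, hX0, hb.le]
  lift X to NNReal using hXt
  lift Y to NNReal using hYt
  have hx : 0 < (X : ℝ) := by
    rw [NNReal.coe_pos]; exact pos_iff_ne_zero.2 (by simpa using hX0)
  have hy : 0 < (Y : ℝ) := by
    rw [NNReal.coe_pos]; exact pos_iff_ne_zero.2 (by simpa using hY0)
  refine (h (((X : ℝ) / Y) ^ (1 / (α + β))) (by positivity)).trans ?_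
  have e1 : ∀ t : ℝ, (((X : ℝ) / Y) ^ (1 / (α + β))) ^ t = X ^ (t / (α + β)) *
      (Y : ℝ) ^ (-t / (α + β)) := fun t => by
    rw [← Real.rpow_mul (by positivity), Real.div_rpow hx.le hy.le, neg_div, Real.rpow_neg hy.le,
      div_eq_mul_inv, one_div_mul_eq_div]
  have e2 : β / (α + β) = 1 + -α / (α + β) := by field_simp; ring
  have e3 : α / (α + β) = 1 + -β / (α + β) := by field_simp; ring
  have f1 : ENNReal.ofReal ((((X : ℝ) / Y) ^ (1 / (α + β))) ^ (-α)) * X =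
      X ^ (β / (α + β)) * Y ^ (α / (α + β)) := by
    rw [e1, ← ENNReal.ofReal_coe_nnreal, ← ENNReal.ofReal_coe_nnreal,
      ENNReal.ofReal_rpow_of_pos hx, ENNReal.ofReal_rpow_of_pos hy,
      ← ENNReal.ofReal_mul (by positivity), ← ENNReal.ofReal_mul (by positivity), neg_neg, e2,
      Real.rpow_add hx, Real.rpow_one]
    ring_nf
  have f2 : ENNReal.ofReal ((((X : ℝ) / Y) ^ (1 / (α + β))) ^ β) * Y =
      X ^ (β / (α + β)) * Y ^ (α / (α + β)) := by
    rw [e1, ← ENNReal.ofReal_coe_nnreal, ← ENNReal.ofReal_coe_nnreal,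
      ENNReal.ofReal_rpow_of_pos hx, ENNReal.ofReal_rpow_of_pos hy,
      ← ENNReal.ofReal_mul (by positivity), ← ENNReal.ofReal_mul (by positivity), e3,
      Real.rpow_add hy, Real.rpow_one]
    ring_nf
  rw [f1, f2, ← two_mul, mul_left_comm, mul_assoc]

/-- Sufficiency of the condition on `β`, for a general Euclidean space. -/
theorem SchwartzMap.exists_eLpNorm_le_mul_rpow {V : Type*} [NormedAddCommGroup V]
    [InnerProductSpace ℝ V] [FiniteDimensional ℝ V] [MeasurableSpace V] [BorelSpace V]
    [Nontrivial V]
    {q q' : ℝ≥0∞} (hq : 1 ≤ q) (hqt : q ≠ ∞) (hconj : 1 / q + 1 / q' = 1)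
    {α β : ℝ} (hα : 0 < α) (hβ : 0 < β)
    (hcond : q < 2 → (Module.finrank ℝ V : ℝ) * ((1 / q).toReal - 1 / 2) < β) :
    ∃ C : ℝ, 0 < C ∧ ∀ f : SchwartzMap V ℂ,
      eLpNorm f q volume ≤ ENNReal.ofReal C *
        (eLpNorm (fun x => ‖x‖ ^ α * ‖f x‖) q volume ^ (β / (α + β)) *
          eLpNorm (fun ξ => ‖ξ‖ ^ β * ‖𝓕 (f : V → ℂ) ξ‖) q' volume ^ (α / (α + β))) := by
  obtain ⟨C, hC, hmain⟩ := exists_eLpNorm_le_add (V := V) hq hqt hconj hα hβ hcond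
  have hq0 : q ≠ 0 := by rintro rfl; simp at hq
  have hq'0 : q' ≠ 0 := by rintro rfl; simp at hconj
  have hr : q⁻¹.toReal + q'⁻¹.toReal = 1 := by
    simp only [one_div] at hconj
    rw [← ENNReal.toReal_add (by simpa) (by simpa), hconj, ENNReal.toReal_one]
  have hne : ∀ᵐ x : V, x ≠ 0 := by
    rw [ae_iff]
    simp
  have hpos : ∀ {γ : ℝ} {x : V} {z : ℂ}, x ≠ 0 → ‖x‖ ^ γ * ‖z‖ = 0 → z = 0 := by
    intro γ x z hx h
    have : 0 < ‖x‖ ^ γ := Real.rpow_pos_of_pos (norm_pos_iff.2 hx) γ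
    simpa [this.ne'] using h
  refine ⟨2 * (C.toReal + 1), by positivity, fun f => ?_⟩
  have hFc : Continuous (𝓕 (f : V → ℂ)) := by
    rw [← SchwartzMap.fourier_coe]; exact (𝓕 f).continuous
  have hcast : ENNReal.ofReal (2 * (C.toReal + 1)) = 2 * (C + 1) := by
    rw [ENNReal.ofReal_mul zero_le_two, ENNReal.ofReal_add (by positivity) zero_le_one,
      ENNReal.ofReal_toReal hC]
    simp
  rw [hcast]
  refine ENNReal.le_rpow_mul_rpow_of_forall_le hα hβ (by simp) (fun h => ?_) (fun h => ?_) ?_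
  · replace h := (eLpNorm_eq_zero_iff ((continuous_norm.rpow_const fun _ => Or.inr hα.le).mul
      f.continuous.norm).aestronglyMeasurable hq0).1 h
    rw [eLpNorm_eq_zero_iff f.continuous.aestronglyMeasurable hq0]
    filter_upwards [h, hne] with x hx hx0 using hpos hx0 hx
  · replace h := (eLpNorm_eq_zero_iff ((continuous_norm.rpow_const fun _ => Or.inr hβ.le).mul
      hFc.norm).aestronglyMeasurable hq'0).1 h
    have h0 : eLpNorm (𝓕 (f : V → ℂ)) 2 volume = 0 := by
      rw [eLpNorm_eq_zero_iff hFc.aestronglyMeasurable two_ne_zero]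
      filter_upwards [h, hne] with x hx hx0 using hpos hx0 hx
    rw [f.eLpNorm_fourier_two, eLpNorm_eq_zero_iff f.continuous.aestronglyMeasurable
      two_ne_zero] at h0
    rwa [eLpNorm_eq_zero_iff f.continuous.aestronglyMeasurable hq0]
  · intro r hr0
    let e : V ≃L[ℝ] V := ContinuousLinearEquiv.smulLeft (Units.mk0 r hr0.ne')
    let g : SchwartzMap V ℂ := SchwartzMap.compCLMOfContinuousLinearEquiv ℂ e f
    have hg : (g : V → ℂ) = fun x => f (r • x) := rfl
    have hgF : ∀ ξ, 𝓕 (g : V → ℂ) ξ =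
        (r ^ (-(Module.finrank ℝ V : ℝ)) : ℝ) • 𝓕 (f : V → ℂ) (r⁻¹ • ξ) := fun ξ => by
      rw [hg, Real.fourier_comp_smul _ hr0]
    have hm := hmain g
    have hY : (fun ξ => ‖ξ‖ ^ β * ‖𝓕 (g : V → ℂ) ξ‖) =
        (r ^ (-(Module.finrank ℝ V : ℝ)) : ℝ) •
          fun ξ => ‖ξ‖ ^ β * ‖𝓕 (f : V → ℂ) (r⁻¹ • ξ)‖ := by
      ext ξ
      rw [hgF, norm_smul, Real.norm_of_nonneg (by positivity), Pi.smul_apply, smul_eq_mul]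
      ring
    rw [hY, eLpNorm_const_smul, Real.enorm_of_nonneg (by positivity),
      eLpNorm_rpow_norm_mul_comp_smul _ _ _ (inv_pos.2 hr0), hg,
      eLpNorm_rpow_norm_mul_comp_smul _ _ _ hr0, eLpNorm_comp_smul_eq _ _ _ hr0] at hm
    set n := (Module.finrank ℝ V : ℝ)
    set X := eLpNorm (fun x => ‖x‖ ^ α * ‖f x‖) q volume
    set Y := eLpNorm (fun ξ => ‖ξ‖ ^ β * ‖𝓕 (f : V → ℂ) ξ‖) q' volume
    have e1 : ENNReal.ofReal (r ^ (-α - n * q⁻¹.toReal)) =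
        ENNReal.ofReal (r ^ (-n * q⁻¹.toReal)) * ENNReal.ofReal (r ^ (-α)) := by
      rw [← ENNReal.ofReal_mul (by positivity), ← Real.rpow_add hr0]
      ring_nf
    have e2 : ENNReal.ofReal (r ^ (-n)) * (ENNReal.ofReal (r⁻¹ ^ (-β - n * q'⁻¹.toReal)) * Y) =
        ENNReal.ofReal (r ^ (-n * q⁻¹.toReal)) * (ENNReal.ofReal (r ^ β) * Y) := by
      rw [← mul_assoc, ← mul_assoc, ← ENNReal.ofReal_mul (by positivity),
        ← ENNReal.ofReal_mul (by positivity), Real.inv_rpow hr0.le, ← Real.rpow_neg hr0.le,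
        ← Real.rpow_add hr0, ← Real.rpow_add hr0]
      congr 3
      linear_combination n * hr
    rw [e1, e2, mul_assoc, ← mul_add, mul_left_comm, ENNReal.mul_le_mul_iff_right] at hm
    · exact hm.trans (by gcongr; exact le_self_add)
    · simp only [ne_eq, ENNReal.ofReal_eq_zero, not_le]
      positivity
    · exact ENNReal.ofReal_ne_top

theorem exists_one_add_pow_mul_exp_neg_mul_sq_le (n : ℕ) {c : ℝ} (hc : 0 < c) :
    ∃ C : ℝ, 0 < C ∧ ∀ t : ℝ, 0 ≤ t → (1 + t) ^ n * Real.exp (-c * t ^ 2) ≤ C := by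
  refine ⟨n.factorial * Real.exp (1 + 1 / (4 * c)), by positivity, fun t ht => ?_⟩
  have h1 := Real.pow_div_factorial_le_exp (1 + t) (by positivity) n
  rw [div_le_iff₀' (by positivity)] at h1
  calc (1 + t) ^ n * Real.exp (-c * t ^ 2)
      ≤ (n.factorial * Real.exp (1 + t)) * Real.exp (-c * t ^ 2) := by gcongr
    _ = n.factorial * Real.exp (1 + t + -c * t ^ 2) := by rw [Real.exp_add (1 + t), mul_assoc]
    _ ≤ _ := by
      refine mul_le_mul_of_nonneg_left (Real.exp_le_exp.2 ?_) (by positivity)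
      have h2 : 1 / (4 * c) - t + c * t ^ 2 = c * (t - 1 / (2 * c)) ^ 2 := by
        field_simp
        ring
      nlinarith [mul_nonneg hc.le (sq_nonneg (t - 1 / (2 * c)))]

theorem iteratedDeriv_cexp_neg_mul_ofReal (b : ℂ) (n : ℕ) :
    iteratedDeriv n (fun t : ℝ => Complex.exp (-b * t)) =
      fun t : ℝ => (-b) ^ n * Complex.exp (-b * t) := by
  induction n with
  | zero => simp
  | succ n ih =>
    rw [iteratedDeriv_succ, ih]
    ext t
    have h1 : HasDerivAt (fun t : ℝ => -b * (t : ℂ)) (-b) t := by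
      simpa using (Complex.ofRealCLM.hasDerivAt (x := t)).const_mul (-b)
    rw [(h1.cexp.const_mul ((-b) ^ n)).deriv]
    ring

theorem SchwartzMap.exists_coe_eq_gaussian (V : Type*) [NormedAddCommGroup V]
    [InnerProductSpace ℝ V] {b : ℂ} (hb : 0 < b.re) :
    ∃ g : SchwartzMap V ℂ, ∀ x, g x = Complex.exp (-b * (‖x‖ : ℂ) ^ 2) := by
  let G : ℝ → ℂ := fun t => Complex.exp (-b * t)
  have hG : ContDiff ℝ (⊤ : ℕ∞) G :=
    Complex.contDiff_exp.comp (contDiff_const.mul Complex.ofRealCLM.contDiff)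
  have hN : ContDiff ℝ (⊤ : ℕ∞) fun x : V => ‖x‖ ^ 2 := contDiff_norm_sq ℝ
  suffices h : ∀ k n : ℕ, ∃ C : ℝ, ∀ x : V,
      ‖x‖ ^ k * ‖iteratedFDeriv ℝ n (G ∘ fun x : V => ‖x‖ ^ 2) x‖ ≤ C from
    ⟨⟨G ∘ fun x => ‖x‖ ^ 2, hG.comp hN, h⟩, fun x => by
      change Complex.exp (-b * ((‖x‖ ^ 2 : ℝ) : ℂ)) = _
      push_cast
      rfl⟩
  intro k n
  obtain ⟨m, D, hD0, hD⟩ :=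
    (Function.hasTemperateGrowth_norm_sq V).norm_iteratedFDeriv_le_uniform n
  obtain ⟨C, hC0, hC⟩ := exists_one_add_pow_mul_exp_neg_mul_sq_le (k + m * n) hb
  refine ⟨n.factorial * (1 + ‖b‖) ^ n * (1 + D) ^ n * C, fun x => ?_⟩
  have key := norm_iteratedFDeriv_comp_le hG hN (n := n) (by exact_mod_cast le_top) x
    (C := (1 + ‖b‖) ^ n * Real.exp (-b.re * ‖x‖ ^ 2)) (D := (1 + D) * (1 + ‖x‖) ^ m)
    (fun i hi => by
      rw [norm_iteratedFDeriv_eq_norm_iteratedDeriv, iteratedDeriv_cexp_neg_mul_ofReal, norm_mul,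
        norm_pow, norm_neg, Complex.norm_exp]
      have : (-b * ((‖x‖ ^ 2 : ℝ) : ℂ)).re = -b.re * ‖x‖ ^ 2 := by
        rw [Complex.re_mul_ofReal, Complex.neg_re]
      rw [this]
      gcongr
      calc ‖b‖ ^ i ≤ (1 + ‖b‖) ^ i := by gcongr; linarith
        _ ≤ _ := pow_le_pow_right₀ (by linarith [norm_nonneg b]) hi)
    (fun i hi1 hi => (hD i hi x).trans (by
      have h1 : 1 ≤ (1 + ‖x‖) ^ m := one_le_pow₀ (by linarith [norm_nonneg x])
      calc D * (1 + ‖x‖) ^ m ≤ (1 + D) * (1 + ‖x‖) ^ m := by gcongr; linarith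
        _ ≤ _ := le_self_pow₀ (by nlinarith) (by lia)))
  calc ‖x‖ ^ k * ‖iteratedFDeriv ℝ n (G ∘ fun x : V => ‖x‖ ^ 2) x‖
      ≤ (1 + ‖x‖) ^ k * (n.factorial * ((1 + ‖b‖) ^ n * Real.exp (-b.re * ‖x‖ ^ 2)) *
          ((1 + D) * (1 + ‖x‖) ^ m) ^ n) := by
        gcongr
        linarith
    _ = n.factorial * (1 + ‖b‖) ^ n * (1 + D) ^ n *
          ((1 + ‖x‖) ^ (k + m * n) * Real.exp (-b.re * ‖x‖ ^ 2)) := by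
        rw [mul_pow, ← pow_mul, pow_add]
        ring
    _ ≤ _ := by
        gcongr
        exact hC _ (norm_nonneg x)

theorem SchwartzMap.exists_chirp (V : Type*) [NormedAddCommGroup V]
    [InnerProductSpace ℝ V] [FiniteDimensional ℝ V] [MeasurableSpace V] [BorelSpace V]
    {w : ℝ} (hw : 1 ≤ w) :
    ∃ (g : SchwartzMap V ℂ) (a : V → ℂ), Continuous a ∧ (∀ x, ‖a x‖ = 1) ∧
      (∀ x, g x = Real.exp (-Real.pi * ‖x‖ ^ 2) * a x) ∧
      ∀ ξ, ‖𝓕 (g : V → ℂ) ξ‖ =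
        w ^ (-(Module.finrank ℝ V : ℝ) / 2) * Real.exp (-Real.pi * (‖ξ‖ / w) ^ 2) := by
  have hw0 : 0 < w := by linarith
  have hpi := Real.pi_pos
  set N := √(w ^ 2 - 1)
  have hN : N ^ 2 = w ^ 2 - 1 := Real.sq_sqrt (by nlinarith)
  set b : ℂ := ⟨Real.pi, -(Real.pi * N)⟩
  have hb : 0 < b.re := hpi
  have hbsq : Complex.normSq b = (Real.pi * w) ^ 2 := by
    rw [Complex.normSq_mk]
    linear_combination Real.pi ^ 2 * hN
  have hbn : ‖b‖ = Real.pi * w := by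
    rw [Complex.norm_def, hbsq, Real.sqrt_sq (by positivity)]
  obtain ⟨g, hg⟩ := SchwartzMap.exists_coe_eq_gaussian V hb
  have hcast : ∀ x : V, (‖x‖ : ℂ) ^ 2 = ((‖x‖ ^ 2 : ℝ) : ℂ) := fun x => by push_cast; rfl
  refine ⟨g, fun x => Complex.exp ((Real.pi * N * ‖x‖ ^ 2 : ℝ) * Complex.I), by fun_prop,
    fun x => Complex.norm_exp_ofReal_mul_I _, fun x => ?_, fun ξ => ?_⟩
  · rw [hg, Complex.ofReal_exp, ← Complex.exp_add, hcast]
    congr 1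
    apply Complex.ext <;> simp [b] <;> ring
  · have hgf : (g : V → ℂ) = fun x => Complex.exp (-b * (‖x‖ : ℂ) ^ 2) := funext hg
    have hex : (Module.finrank ℝ V : ℂ) / 2 = ((Module.finrank ℝ V / 2 : ℝ) : ℂ) := by
      push_cast
      rfl
    rw [hgf, fourier_gaussian_innerProductSpace hb, norm_mul, hex, Complex.norm_cpow_real,
      Complex.norm_exp, norm_div, hbn, Complex.norm_real, Real.norm_of_nonneg hpi.le]
    congr 1
    · rw [← div_div, div_self hpi.ne', one_div, Real.inv_rpow hw0.le, ← Real.rpow_neg hw0.le]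
      ring_nf
    · congr 1
      have : -(Real.pi : ℂ) ^ 2 * (‖ξ‖ : ℂ) ^ 2 / b =
          ((-Real.pi ^ 2 * ‖ξ‖ ^ 2 : ℝ) : ℂ) * b⁻¹ := by
        push_cast
        rfl
      rw [this, Complex.re_ofReal_mul, Complex.inv_re, hbsq]
      simp only [b]
      field_simp

/-- The sum of `a k` over `k < J`, with sign `+` for `k ∈ S` and `-` otherwise. -/
noncomputable def signedSum {M : Type*} [AddCommGroup M] (a : ℕ → M) (J : ℕ) (S : Finset ℕ) : M :=
  ∑ k ∈ Finset.range J, if k ∈ S then a k else -a k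

theorem sum_powerset_signedSum_succ {M : Type*} [AddCommGroup M] (a : ℕ → M) (J : ℕ) (F : M → ℝ) :
    ∑ S ∈ (Finset.range (J + 1)).powerset, F (signedSum a (J + 1) S) =
      ∑ S ∈ (Finset.range J).powerset,
        (F (signedSum a J S + a J) + F (signedSum a J S - a J)) := by
  rw [Finset.range_add_one, Finset.sum_powerset_insert Finset.notMem_range_self, add_comm,
    ← Finset.sum_add_distrib]
  refine Finset.sum_congr rfl fun S hS => ?_
  have hJ : J ∉ S := fun h => Finset.notMem_range_self (Finset.mem_powerset.1 hS h)
  have h1 : signedSum a (J + 1) S = signedSum a J S - a J := by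
    rw [signedSum, Finset.sum_range_succ, if_neg hJ, ← sub_eq_add_neg, signedSum]
  have h2 : signedSum a (J + 1) (insert J S) = signedSum a J S + a J := by
    rw [signedSum, Finset.sum_range_succ, if_pos (Finset.mem_insert_self _ _), signedSum]
    congr 1
    refine Finset.sum_congr rfl fun k hk => ?_
    have : k ≠ J := (Finset.mem_range.1 hk).ne
    simp [Finset.mem_insert, this]
  rw [h1, h2]

theorem sum_norm_signedSum_sq {a : ℕ → ℂ} (ha : ∀ k, ‖a k‖ = 1) (J : ℕ) :
    ∑ S ∈ (Finset.range J).powerset, ‖signedSum a J S‖ ^ 2 = 2 ^ J * J := by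
  induction J with
  | zero => simp [signedSum]
  | succ J ih =>
    have h : ∀ z : ℂ, ‖z + a J‖ ^ 2 + ‖z - a J‖ ^ 2 = 2 * ‖z‖ ^ 2 + 2 := fun z => by
      have := parallelogram_law_with_norm ℝ z (a J)
      rw [ha] at this
      linarith
    rw [sum_powerset_signedSum_succ a J (fun z => ‖z‖ ^ 2)]
    simp only [h]
    rw [Finset.sum_add_distrib, ← Finset.mul_sum, ih]
    simp
    ring

theorem sum_norm_signedSum_pow_four_le {a : ℕ → ℂ} (ha : ∀ k, ‖a k‖ = 1) (J : ℕ) :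
    ∑ S ∈ (Finset.range J).powerset, ‖signedSum a J S‖ ^ 4 ≤ 2 ^ J * (3 * J ^ 2) := by
  induction J with
  | zero => simp [signedSum]
  | succ J ih =>
    have h : ∀ z : ℂ, ‖z + a J‖ ^ 4 + ‖z - a J‖ ^ 4 ≤ 2 * ‖z‖ ^ 4 + 12 * ‖z‖ ^ 2 + 2 := fun z => by
      have h1 := norm_add_sq_real z (a J)
      have h2 := norm_sub_sq_real z (a J)
      have h3 := real_inner_mul_inner_self_le z (a J)
      rw [real_inner_self_eq_norm_sq, real_inner_self_eq_norm_sq] at h3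
      rw [ha] at h1 h2 h3
      have h4 : ∀ y : ℝ, y ^ 4 = (y ^ 2) ^ 2 := fun y => by ring
      rw [h4, h4, h1, h2]
      nlinarith
    rw [sum_powerset_signedSum_succ a J (fun z => ‖z‖ ^ 4)]
    refine (Finset.sum_le_sum fun S _ => h _).trans ?_
    rw [Finset.sum_add_distrib, Finset.sum_add_distrib, ← Finset.mul_sum, ← Finset.mul_sum,
      sum_norm_signedSum_sq ha]
    simp only [Finset.sum_const, Finset.card_powerset, Finset.card_range, nsmul_eq_mul]
    push_cast
    have : (0 : ℝ) < 2 ^ J := by positivity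
    rw [pow_succ]
    nlinarith

/-- The upper half of Khintchine's inequality, up to the constant. -/
theorem sum_norm_signedSum_rpow_le {a : ℕ → ℂ} (ha : ∀ k, ‖a k‖ = 1) {q : ℝ} (hq : 0 ≤ q)
    (hq2 : q ≤ 2) {J : ℕ} (hJ : 0 < J) :
    ∑ S ∈ (Finset.range J).powerset, ‖signedSum a J S‖ ^ q ≤ 2 ^ J * (2 * (J : ℝ) ^ (q / 2)) := by
  have hJ' : (0 : ℝ) < J := by exact_mod_cast hJ
  have h : ∀ y : ℝ, 0 ≤ y → y ^ q ≤ (J : ℝ) ^ (q / 2) * (1 + (J : ℝ)⁻¹ * y ^ 2) := fun y hy => by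
    rw [← one_mul y, ← Real.mul_self_sqrt hJ'.le]
    have hs : 0 < √(J : ℝ) := Real.sqrt_pos.2 hJ'
    set z := y / √J with hz
    have hyz : y = √J * z := by rw [hz]; field_simp
    have hz0 : 0 ≤ z := by positivity
    have hp : (√(J : ℝ) * √J) ^ (q / 2) = √J ^ q := by
      rw [← pow_two, ← Real.rpow_natCast, ← Real.rpow_mul hs.le]
      norm_num
      congr 1
      ring
    rw [hp, hyz, one_mul, Real.mul_rpow hs.le hz0]
    have : (√(J : ℝ) * √J)⁻¹ * (√J * z) ^ 2 = z ^ 2 := by field_simp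
    rw [this]
    refine mul_le_mul_of_nonneg_left ?_ (by positivity)
    rcases le_total z 1 with h1 | h1
    · nlinarith [Real.rpow_le_one hz0 h1 hq]
    · have := Real.rpow_le_rpow_of_exponent_le h1 hq2
      rw [Real.rpow_two] at this
      linarith
  refine (Finset.sum_le_sum fun S _ => h _ (norm_nonneg _)).trans (le_of_eq ?_)
  rw [← Finset.mul_sum, Finset.sum_add_distrib, ← Finset.mul_sum, sum_norm_signedSum_sq ha]
  simp only [Finset.sum_const, Finset.card_powerset, Finset.card_range, nsmul_eq_mul]
  push_cast
  field_simp
  ring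

/-- The lower half of Khintchine's inequality, up to the constant. -/
theorem le_sum_norm_signedSum_rpow {a : ℕ → ℂ} (ha : ∀ k, ‖a k‖ = 1) {q : ℝ} (hq : 0 ≤ q)
    (hq2 : q ≤ 2) {J : ℕ} (hJ : 0 < J) :
    2 ^ J * ((J : ℝ) ^ (q / 2) / 12) ≤ ∑ S ∈ (Finset.range J).powerset, ‖signedSum a J S‖ ^ q := by
  have hJ' : (0 : ℝ) < J := by exact_mod_cast hJ
  have h : ∀ y : ℝ, 0 ≤ y → (J : ℝ) ^ (q / 2) * ((6 * J : ℝ)⁻¹ * y ^ 2 -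
      (6 * J : ℝ)⁻¹ ^ 2 * y ^ 4) ≤ y ^ q := fun y hy => by
    have hs : 0 < √(6 * J : ℝ) := Real.sqrt_pos.2 (by positivity)
    have hsq : √(6 * J : ℝ) ^ 2 = 6 * J := Real.sq_sqrt (by positivity)
    set z := y / √(6 * J) with hz
    have hyz : y = √(6 * J) * z := by rw [hz]; field_simp
    have hz0 : 0 ≤ z := by positivity
    have hp : (J : ℝ) ^ (q / 2) ≤ √(6 * J) ^ q := by
      have : √(6 * J : ℝ) ^ q = (6 * J : ℝ) ^ (q / 2) := by
        rw [Real.sqrt_eq_rpow, ← Real.rpow_mul (by positivity), one_div_mul_eq_div]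
      rw [this]
      exact Real.rpow_le_rpow hJ'.le (by linarith) (by linarith)
    have e1 : (6 * J : ℝ)⁻¹ * y ^ 2 - (6 * J : ℝ)⁻¹ ^ 2 * y ^ 4 = z ^ 2 - z ^ 4 := by
      rw [← hsq, hyz]
      field_simp
    rw [e1]
    nth_rewrite 1 [hyz]
    rw [Real.mul_rpow hs.le hz0]
    rcases le_total z 1 with h1 | h1
    · have h2 : z ^ 2 ≤ z ^ q := by
        rcases hz0.eq_or_lt with h0 | h0
        · rw [← h0]
          simpa using Real.rpow_nonneg le_rfl q
        · rw [← Real.rpow_two]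
          exact Real.rpow_le_rpow_of_exponent_ge h0 h1 hq2
      have h3 : 0 ≤ z ^ 2 - z ^ 4 := by
        have : z ^ 2 ≤ 1 := pow_le_one₀ hz0 h1
        nlinarith [sq_nonneg z]
      have h4 : 0 ≤ z ^ 4 := by positivity
      exact mul_le_mul hp (by linarith) h3 (by positivity)
    · have h3 : z ^ 2 - z ^ 4 ≤ 0 := by
        have : 1 ≤ z ^ 2 := one_le_pow₀ h1
        nlinarith
      exact (mul_nonpos_of_nonneg_of_nonpos (by positivity) h3).trans (by positivity)
  refine le_trans ?_ (Finset.sum_le_sum fun S _ => h _ (norm_nonneg _))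
  rw [← Finset.mul_sum, Finset.sum_sub_distrib, ← Finset.mul_sum, ← Finset.mul_sum,
    sum_norm_signedSum_sq ha]
  have hJq : 0 ≤ (J : ℝ) ^ (q / 2) := by positivity
  rw [div_eq_mul_one_div, mul_left_comm]
  refine mul_le_mul_of_nonneg_left ?_ hJq
  have h4 := mul_le_mul_of_nonneg_left (sum_norm_signedSum_pow_four_le ha J)
    (by positivity : (0 : ℝ) ≤ (6 * J : ℝ)⁻¹ ^ 2)
  have e : (6 * J : ℝ)⁻¹ * (2 ^ J * J) - (6 * J : ℝ)⁻¹ ^ 2 * (2 ^ J * (3 * J ^ 2)) =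
      2 ^ J * (1 / 12) := by
    field_simp
    norm_num
  linarith

/-- A lacunary sum of dilates of `u ^ γ * exp (-π u ^ 2)` is bounded. -/
theorem exists_sum_rpow_mul_exp_neg_mul_sq_le {γ : ℝ} (hγ : 0 < γ) :
    ∃ C : ℝ, 0 < C ∧ ∀ (J : ℕ) (t : ℝ), 0 ≤ t →
      ∑ k ∈ Finset.range J, (t / 2 ^ ((k : ℝ) / γ)) ^ γ *
        Real.exp (-Real.pi * (t / 2 ^ ((k : ℝ) / γ)) ^ 2) ≤ C := by
  obtain ⟨C, hC0, hC⟩ := exists_one_add_pow_mul_exp_neg_mul_sq_le (⌈γ⌉₊ + ⌈γ⌉₊) Real.pi_pos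
  have hm : ∀ u : ℝ, 0 ≤ u → u ^ γ * Real.exp (-Real.pi * u ^ 2) ≤
      6 * C * (2 * u ^ γ / (1 + 2 * u ^ γ) - u ^ γ / (1 + u ^ γ)) := fun u hu => by
    have h1 : 1 ≤ (1 + u) ^ ⌈γ⌉₊ := one_le_pow₀ (by linarith)
    have h2 : u ^ γ ≤ (1 + u) ^ ⌈γ⌉₊ := by
      calc u ^ γ ≤ (1 + u) ^ γ := Real.rpow_le_rpow hu (by linarith) hγ.le
        _ ≤ (1 + u) ^ (⌈γ⌉₊ : ℝ) :=
          Real.rpow_le_rpow_of_exponent_le (by linarith) (Nat.le_ceil γ)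
        _ = _ := Real.rpow_natCast _ _
    have h3 := hC u hu
    rw [pow_add] at h3
    have hs : 0 ≤ u ^ γ := by positivity
    set s := u ^ γ
    set P := (1 + u) ^ ⌈γ⌉₊
    set e := Real.exp (-Real.pi * u ^ 2)
    have he : 0 < e := Real.exp_pos _
    have h4 : e * ((1 + s) * (1 + 2 * s)) ≤ 6 * C := by
      calc e * ((1 + s) * (1 + 2 * s)) ≤ e * ((2 * P) * (3 * P)) := by
            gcongr <;> linarith
        _ = 6 * (P * P * e) := by ring
        _ ≤ _ := by linarith
    have h5 : 2 * s / (1 + 2 * s) - s / (1 + s) = s / ((1 + s) * (1 + 2 * s)) := by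
      field_simp
      ring
    rw [h5, mul_div_assoc', le_div_iff₀ (by positivity)]
    nlinarith
  refine ⟨6 * C, by positivity, fun J t ht => ?_⟩
  let f : ℕ → ℝ := fun k => 2 * t ^ γ / 2 ^ k / (1 + 2 * t ^ γ / 2 ^ k)
  have hT : 0 ≤ t ^ γ := by positivity
  have hw : ∀ k : ℕ, (t / 2 ^ ((k : ℝ) / γ)) ^ γ = t ^ γ / 2 ^ k := fun k => by
    rw [Real.div_rpow ht (by positivity), ← Real.rpow_mul zero_le_two, div_mul_cancel₀ _ hγ.ne',
      Real.rpow_natCast]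
  calc _ ≤ ∑ k ∈ Finset.range J, 6 * C * (f k - f (k + 1)) := by
        refine Finset.sum_le_sum fun k _ => (hm _ (by positivity)).trans (le_of_eq ?_)
        simp only [hw, f]
        have : 2 * t ^ γ / 2 ^ (k + 1) = t ^ γ / 2 ^ k := by
          rw [pow_succ]
          field_simp
        rw [this, mul_div_assoc, mul_div_assoc, mul_div_assoc]
    _ = 6 * C * (f 0 - f J) := by rw [← Finset.mul_sum, Finset.sum_range_sub']
    _ ≤ 6 * C * 1 := by
        refine mul_le_mul_of_nonneg_left ?_ (by positivity)
        have h1 : 0 ≤ f J := by positivity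
        have h2 : f 0 ≤ 1 := by
          refine div_le_one_of_le₀ ?_ (by positivity)
          linarith
        linarith
    _ = _ := mul_one _

theorem integrable_norm_rpow_neg_finrank_mul {V : Type*} [NormedAddCommGroup V]
    [InnerProductSpace ℝ V] [FiniteDimensional ℝ V] [MeasurableSpace V] [BorelSpace V]
    [Nontrivial V] {γ : ℝ} (hγ : 0 < γ) :
    Integrable fun ξ : V => ‖ξ‖ ^ (-(Module.finrank ℝ V : ℝ)) *
      (‖ξ‖ ^ γ * Real.exp (-Real.pi * ‖ξ‖ ^ 2)) := by
  rw [integrable_fun_norm_addHaar volume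
    (f := fun y => y ^ (-(Module.finrank ℝ V : ℝ)) * (y ^ γ * Real.exp (-Real.pi * y ^ 2)))]
  refine (integrableOn_rpow_mul_exp_neg_mul_sq Real.pi_pos
    (by linarith : -1 < γ - 1)).congr_fun (fun y hy => ?_) measurableSet_Ioi
  have hy : 0 < y := hy
  have hn : ((Module.finrank ℝ V - 1 : ℕ) : ℝ) = Module.finrank ℝ V - 1 := by
    rw [Nat.cast_sub Module.finrank_pos, Nat.cast_one]
  simp only [smul_eq_mul]
  rw [← Real.rpow_natCast y (_ - 1), hn, ← mul_assoc, ← mul_assoc, ← Real.rpow_add hy,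
    ← Real.rpow_add hy]
  ring_nf

set_option maxHeartbeats 1000000 in
/-- The weighted `L^p` bound for a lacunary sum of dilated Gaussians. -/
theorem exists_eLpNorm_rpow_norm_mul_sum_le {V : Type*} [NormedAddCommGroup V]
    [InnerProductSpace ℝ V] [FiniteDimensional ℝ V] [MeasurableSpace V] [BorelSpace V]
    [Nontrivial V] {p : ℝ≥0∞} (hp : 1 ≤ p) {β γ : ℝ} (hγ : 0 < γ)
    (hβγ : γ = β + Module.finrank ℝ V * p⁻¹.toReal) (hγn : γ ≤ Module.finrank ℝ V / 2) :
    ∃ C : ℝ≥0∞, C ≠ ∞ ∧ ∀ (J : ℕ) (h : V → ℂ),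
      (∀ ξ, ‖h ξ‖ ≤ ∑ k ∈ Finset.range J, (2 ^ ((k : ℝ) / γ)) ^ (-(Module.finrank ℝ V : ℝ) / 2) *
        Real.exp (-Real.pi * (‖ξ‖ / 2 ^ ((k : ℝ) / γ)) ^ 2)) →
      eLpNorm (fun ξ => ‖ξ‖ ^ β * ‖h ξ‖) p volume ≤ C * (J : ℝ≥0∞) ^ p⁻¹.toReal := by
  obtain ⟨C, hC0, hC⟩ := exists_sum_rpow_mul_exp_neg_mul_sq_le hγ
  have hint := integrable_norm_rpow_neg_finrank_mul (V := V) hγ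
  set n : ℝ := (Module.finrank ℝ V : ℝ)
  set m : ℝ → ℝ := fun u => u ^ γ * Real.exp (-Real.pi * u ^ 2) with hm
  set w : ℕ → ℝ := fun k => 2 ^ ((k : ℝ) / γ) with hwdef
  have hw1 : ∀ k, 1 ≤ w k := fun k => Real.one_le_rpow one_le_two (by positivity)
  have hw0 : ∀ k, 0 < w k := fun k => one_pos.trans_le (hw1 k)
  have hm0 : ∀ u, 0 ≤ u → 0 ≤ m u := fun u hu => by positivity
  have hne : ∀ᵐ x : V, x ≠ 0 := by
    rw [ae_iff]
    simp
  have hpt : ∀ (J : ℕ) (h : V → ℂ),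
      (∀ ξ, ‖h ξ‖ ≤ ∑ k ∈ Finset.range J, w k ^ (-n / 2) *
        Real.exp (-Real.pi * (‖ξ‖ / w k) ^ 2)) → ∀ ξ : V, ξ ≠ 0 →
      ‖ξ‖ ^ β * ‖h ξ‖ ≤ ‖ξ‖ ^ (-n * p⁻¹.toReal) *
        ∑ k ∈ Finset.range J, m (‖ξ‖ / w k) := fun J h hh ξ hξ => by
    have hξ0 : 0 < ‖ξ‖ := norm_pos_iff.2 hξ
    have e : ‖ξ‖ ^ β = ‖ξ‖ ^ (-n * p⁻¹.toReal) * ‖ξ‖ ^ γ := by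
      rw [← Real.rpow_add hξ0, hβγ]
      ring_nf
    rw [e, mul_assoc]
    refine mul_le_mul_of_nonneg_left ?_ (by positivity)
    refine (mul_le_mul_of_nonneg_left (hh ξ) (by positivity)).trans ?_
    rw [Finset.mul_sum]
    refine Finset.sum_le_sum fun k _ => ?_
    rw [hm, ← mul_assoc]
    refine mul_le_mul_of_nonneg_right ?_ (by positivity)
    rw [Real.div_rpow hξ0.le (hw0 k).le, div_eq_mul_inv (‖ξ‖ ^ γ), ← Real.rpow_neg (hw0 k).le]
    refine mul_le_mul_of_nonneg_left ?_ (by positivity)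
    exact Real.rpow_le_rpow_of_exponent_le (hw1 k) (by linarith)
  rcases eq_or_ne p ∞ with rfl | hpt'
  · refine ⟨ENNReal.ofReal C, ENNReal.ofReal_ne_top, fun J h hh => ?_⟩
    simp only [ENNReal.inv_top, ENNReal.toReal_zero, ENNReal.rpow_zero, mul_one]
    rw [eLpNorm_exponent_top]
    refine eLpNormEssSup_le_of_ae_bound ?_
    filter_upwards [hne] with ξ hξ
    have h1 := hpt J h hh ξ hξ
    simp only [ENNReal.inv_top, ENNReal.toReal_zero, mul_zero, Real.rpow_zero, one_mul] at h1
    rw [Real.norm_of_nonneg (by positivity)]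
    exact h1.trans (hC J _ (norm_nonneg _))
  have hp0 : p ≠ 0 := by rintro rfl; simp at hp
  set e := p⁻¹.toReal with he
  have he0 : 0 < e := ENNReal.toReal_pos (by simpa) (by simpa)
  have he1 : e ≤ 1 := by
    have := ENNReal.toReal_mono ENNReal.one_ne_top (ENNReal.inv_le_one.2 hp)
    simpa [he] using this
  set ψ : V → ℝ := fun ξ => ‖ξ‖ ^ (-n) * m ‖ξ‖ with hψ
  have hhk : ∀ k, eLpNorm (fun ξ : V => ‖ξ‖ ^ (-n) * m (‖ξ‖ / w k)) 1 volume =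
      eLpNorm ψ 1 volume := fun k => by
    have h1 : (fun ξ : V => ‖ξ‖ ^ (-n) * m (‖ξ‖ / w k)) =
        (w k ^ (-n)) • fun ξ : V => ψ ((w k)⁻¹ • ξ) := by
      ext ξ
      simp only [Pi.smul_apply, smul_eq_mul, hψ, norm_smul, norm_inv,
        Real.norm_of_nonneg (hw0 k).le]
      rw [Real.mul_rpow (by have := hw0 k; positivity) (norm_nonneg _), Real.inv_rpow (hw0 k).le,
        inv_mul_eq_div]
      have := Real.rpow_pos_of_pos (hw0 k) (-n)
      field_simp
    rw [h1, eLpNorm_const_smul, eLpNorm_comp_smul_eq _ _ _ (inv_pos.2 (hw0 k)),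
      Real.enorm_of_nonneg (by have := hw0 k; positivity), ← mul_assoc,
      ← ENNReal.ofReal_mul (by have := hw0 k; positivity), Real.inv_rpow (hw0 k).le]
    have := (Real.rpow_pos_of_pos (hw0 k) (-n)).ne'
    have h2 : -(Module.finrank ℝ V : ℝ) * (1 : ℝ≥0∞)⁻¹.toReal = -n := by
      rw [inv_one, ENNReal.toReal_one, mul_one]
    rw [h2, mul_inv_cancel₀ this, ENNReal.ofReal_one, one_mul]
  have hH : ∀ J : ℕ, eLpNorm (fun ξ : V => ‖ξ‖ ^ (-n) * ∑ k ∈ Finset.range J, m (‖ξ‖ / w k)) 1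
      volume ≤ J * eLpNorm ψ 1 volume := fun J => by
    have h1 := eLpNorm_sum_le (μ := (volume : Measure V)) (p := 1) (s := Finset.range J)
      (f := fun k (ξ : V) => ‖ξ‖ ^ (-n) * m (‖ξ‖ / w k)) (fun k _ => by
        refine Measurable.aestronglyMeasurable ?_
        simp only [hm]
        fun_prop) le_rfl
    simp only [hhk, Finset.sum_const, Finset.card_range, nsmul_eq_mul] at h1
    refine le_of_eq_of_le ?_ h1
    congr 1
    ext ξ
    rw [Finset.sum_apply, Finset.mul_sum]
  refine ⟨ENNReal.ofReal (C ^ (1 - e)) * eLpNorm ψ 1 volume ^ e, ?_, fun J h hh => ?_⟩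
  · exact ENNReal.mul_ne_top ENNReal.ofReal_ne_top (ENNReal.rpow_ne_top_of_nonneg he0.le
      (memLp_one_iff_integrable.2 hint).eLpNorm_ne_top)
  set H : V → ℝ := fun ξ => ‖ξ‖ ^ (-n) * ∑ k ∈ Finset.range J, m (‖ξ‖ / w k) with hHdef
  have h1 : eLpNorm (fun ξ => ‖ξ‖ ^ β * ‖h ξ‖) p volume ≤
      ENNReal.ofReal (C ^ (1 - e)) * eLpNorm (fun ξ => ‖H ξ‖ ^ e) p volume := by
    refine eLpNorm_le_mul_eLpNorm_of_ae_le_mul ?_ p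
    filter_upwards [hne] with ξ hξ
    have hξ0 : 0 < ‖ξ‖ := norm_pos_iff.2 hξ
    have hM0 : 0 ≤ ∑ k ∈ Finset.range J, m (‖ξ‖ / w k) :=
      Finset.sum_nonneg fun k _ => hm0 _ (by have := hw0 k; positivity)
    rw [Real.norm_of_nonneg (by positivity), Real.norm_of_nonneg (by positivity),
      Real.norm_of_nonneg (by positivity)]
    refine (hpt J h hh ξ hξ).trans ?_
    have hMC := hC J ‖ξ‖ (norm_nonneg _)
    change ∑ k ∈ Finset.range J, m (‖ξ‖ / w k) ≤ C at hMC
    simp only [hHdef]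
    set M := ∑ k ∈ Finset.range J, m (‖ξ‖ / w k)
    rw [Real.mul_rpow (by positivity) hM0, ← Real.rpow_mul hξ0.le, mul_left_comm]
    refine mul_le_mul_of_nonneg_left ?_ (by positivity)
    calc M = M ^ (1 - e) * M ^ e := by
          rw [← Real.rpow_add' hM0 (by rw [sub_add_cancel]; exact one_ne_zero), sub_add_cancel,
            Real.rpow_one]
      _ ≤ _ := by
          gcongr
  have hpe : p * ENNReal.ofReal e = 1 := by
    rw [he, ENNReal.ofReal_toReal (by simpa), ENNReal.mul_inv_cancel hp0 hpt']
  calc _ ≤ _ := h1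
    _ = ENNReal.ofReal (C ^ (1 - e)) * eLpNorm H 1 volume ^ e := by
        rw [eLpNorm_norm_rpow _ he0, hpe]
    _ ≤ ENNReal.ofReal (C ^ (1 - e)) * (J * eLpNorm ψ 1 volume) ^ e := by
        gcongr
        exact hH J
    _ = _ := by
        rw [ENNReal.mul_rpow_of_nonneg _ _ he0.le]
        ring

theorem norm_signedSum_le {a : ℕ → ℂ} (ha : ∀ k, ‖a k‖ = 1) (J : ℕ) (S : Finset ℕ) :
    ‖signedSum a J S‖ ≤ J := by
  refine (norm_sum_le_of_le _ fun k _ => ?_).trans_eq (by simp : ∑ _k ∈ Finset.range J, (1 : ℝ) = J)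
  split_ifs <;> simp [ha]

theorem measurable_signedSum {X : Type*} [MeasurableSpace X] {a : ℕ → X → ℂ}
    (ha : ∀ k, Measurable (a k)) (J : ℕ) (S : Finset ℕ) :
    Measurable fun x => signedSum (fun k => a k x) J S := by
  refine Finset.measurable_fun_sum _ fun k _ => ?_
  split_ifs
  exacts [ha k, (ha k).neg]

theorem integrable_mul_norm_signedSum_rpow {X : Type*} [MeasurableSpace X] {μ : Measure X}
    {W : X → ℝ} (hW : Integrable W μ) {a : ℕ → X → ℂ} (ha : ∀ k, Measurable (a k))
    (ha1 : ∀ k x, ‖a k x‖ = 1) {r : ℝ} (hr : 0 ≤ r) (J : ℕ) (S : Finset ℕ) :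
    Integrable (fun x => W x * ‖signedSum (fun k => a k x) J S‖ ^ r) μ := by
  refine hW.mul_bdd (c := (J : ℝ) ^ r)
    ((measurable_signedSum ha J S).norm.pow_const r).aestronglyMeasurable ?_
  refine Filter.Eventually.of_forall fun x => ?_
  rw [Real.norm_of_nonneg (by positivity)]
  exact Real.rpow_le_rpow (norm_nonneg _) (norm_signedSum_le (fun k => ha1 k x) J S) hr

/-- Some choice of signs makes the `W₀`-weighted norm large compared with the `W₁`-weighted one. -/
theorem exists_signedSum_integral_le {X : Type*} [MeasurableSpace X] {μ : Measure X}
    {W₀ W₁ : X → ℝ} (h₀ : Integrable W₀ μ) (h₁ : Integrable W₁ μ) (hW₀ : ∀ x, 0 ≤ W₀ x)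
    (hW₁ : ∀ x, 0 ≤ W₁ x) (hpos : 0 < ∫ x, W₀ x ∂μ) {r : ℝ} (hr : 0 ≤ r) (hr2 : r ≤ 2) :
    ∃ l c : ℝ, 0 < l ∧ 0 < c ∧ ∀ a : ℕ → X → ℂ, (∀ k, Measurable (a k)) →
      (∀ k x, ‖a k x‖ = 1) → ∀ J : ℕ, 0 < J → ∃ S : Finset ℕ,
        l * ∫ x, W₁ x * ‖signedSum (fun k => a k x) J S‖ ^ r ∂μ + c * (J : ℝ) ^ (r / 2) ≤
          ∫ x, W₀ x * ‖signedSum (fun k => a k x) J S‖ ^ r ∂μ := by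
  set I₀ := ∫ x, W₀ x ∂μ
  have hI₁ : 0 ≤ ∫ x, W₁ x ∂μ := integral_nonneg hW₁
  set I₁ := ∫ x, W₁ x ∂μ
  refine ⟨I₀ / (48 * (I₁ + 1)), I₀ / 24, by positivity, by positivity, fun a ha ha1 J hJ => ?_⟩
  have i₀ := integrable_mul_norm_signedSum_rpow h₀ ha ha1 hr J
  have i₁ := integrable_mul_norm_signedSum_rpow h₁ ha ha1 hr J
  have hc : ((Finset.range J).powerset.card : ℝ) = 2 ^ J := by simp
  have lower : 2 ^ J * ((J : ℝ) ^ (r / 2) / 12) * I₀ ≤ ∑ S ∈ (Finset.range J).powerset,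
      ∫ x, W₀ x * ‖signedSum (fun k => a k x) J S‖ ^ r ∂μ := by
    rw [← integral_finsetSum _ fun S _ => i₀ S, ← integral_const_mul]
    refine integral_mono (h₀.const_mul _) (integrable_finsetSum _ fun S _ => i₀ S) fun x => ?_
    simp only
    rw [← Finset.mul_sum, mul_comm]
    exact mul_le_mul_of_nonneg_left (le_sum_norm_signedSum_rpow (fun k => ha1 k x) hr hr2 hJ)
      (hW₀ x)
  have upper : ∑ S ∈ (Finset.range J).powerset,
      ∫ x, W₁ x * ‖signedSum (fun k => a k x) J S‖ ^ r ∂μ ≤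
        2 ^ J * (2 * (J : ℝ) ^ (r / 2)) * I₁ := by
    rw [← integral_finsetSum _ fun S _ => i₁ S, ← integral_const_mul]
    refine integral_mono (integrable_finsetSum _ fun S _ => i₁ S) (h₁.const_mul _) fun x => ?_
    simp only
    rw [← Finset.mul_sum, mul_comm _ (W₁ x)]
    exact mul_le_mul_of_nonneg_left (sum_norm_signedSum_rpow_le (fun k => ha1 k x) hr hr2 hJ)
      (hW₁ x)
  obtain ⟨S, -, hS⟩ := Finset.exists_le_of_sum_le (s := (Finset.range J).powerset)
    (Finset.powerset_nonempty _)
    (f := fun S => I₀ / (48 * (I₁ + 1)) * ∫ x, W₁ x * ‖signedSum (fun k => a k x) J S‖ ^ r ∂μ +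
      I₀ / 24 * (J : ℝ) ^ (r / 2))
    (g := fun S => ∫ x, W₀ x * ‖signedSum (fun k => a k x) J S‖ ^ r ∂μ) (by
      refine le_trans ?_ lower
      rw [Finset.sum_add_distrib, ← Finset.mul_sum, Finset.sum_const, nsmul_eq_mul, hc]
      have h := mul_le_mul_of_nonneg_left upper (by positivity : 0 ≤ I₀ / (48 * (I₁ + 1)))
      have h2 : I₀ / (48 * (I₁ + 1)) * (2 ^ J * (2 * (J : ℝ) ^ (r / 2)) * I₁) ≤
          2 ^ J * (J : ℝ) ^ (r / 2) * (I₀ / 24) := by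
        have : I₁ / (I₁ + 1) ≤ 1 := div_le_one_of_le₀ (by linarith) (by linarith)
        calc _ = 2 ^ J * (J : ℝ) ^ (r / 2) * (I₀ / 24) * (I₁ / (I₁ + 1)) := by
              field_simp
              ring
          _ ≤ 2 ^ J * (J : ℝ) ^ (r / 2) * (I₀ / 24) * 1 := by gcongr
          _ = _ := mul_one _
      linarith)
  exact ⟨S, hS⟩

theorem map_signedSum {M N : Type*} [AddCommGroup M] [AddCommGroup N] (φ : M →+ N) (a : ℕ → M)
    (J : ℕ) (S : Finset ℕ) : φ (signedSum a J S) = signedSum (fun k => φ (a k)) J S := by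
  simp only [signedSum, map_sum]
  refine Finset.sum_congr rfl fun k _ => ?_
  split_ifs <;> simp

theorem norm_signedSum_le_sum_norm {M : Type*} [NormedAddCommGroup M] (a : ℕ → M) (J : ℕ)
    (S : Finset ℕ) : ‖signedSum a J S‖ ≤ ∑ k ∈ Finset.range J, ‖a k‖ := by
  refine norm_sum_le_of_le _ fun k _ => ?_
  split_ifs <;> simp

theorem SchwartzMap.signedSum_apply {V : Type*} [NormedAddCommGroup V] [NormedSpace ℝ V]
    (g : ℕ → SchwartzMap V ℂ) (J : ℕ) (S : Finset ℕ) (x : V) :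
    signedSum g J S x = signedSum (fun k => g k x) J S :=
  map_signedSum (AddMonoidHom.mk' (fun f : SchwartzMap V ℂ => f x) fun _ _ => rfl) g J S

theorem SchwartzMap.norm_fourier_signedSum_le {V : Type*} [NormedAddCommGroup V]
    [InnerProductSpace ℝ V] [FiniteDimensional ℝ V] [MeasurableSpace V] [BorelSpace V]
    (g : ℕ → SchwartzMap V ℂ) (J : ℕ) (S : Finset ℕ) (ξ : V) :
    ‖𝓕 ((signedSum g J S : SchwartzMap V ℂ) : V → ℂ) ξ‖ ≤
      ∑ k ∈ Finset.range J, ‖𝓕 (g k : V → ℂ) ξ‖ := by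
  simp only [← SchwartzMap.fourier_coe]
  have h := map_signedSum (AddMonoidHom.mk' (fun f : SchwartzMap V ℂ => (𝓕 f) ξ) fun f f' => by
    rw [FourierTransform.fourier_add, add_apply]) g J S
  simp only [AddMonoidHom.mk'_apply] at h
  rw [h]
  exact norm_signedSum_le_sum_norm _ J S

theorem ENNReal.le_mul_of_le_mul_rpow_mul_rpow {F A B C K : ℝ≥0∞} {α β : ℝ} (hα : 0 < α)
    (hβ : 0 < β) (hF : F ≠ 0) (hF' : F ≠ ∞) (hA : A ≤ K * F)
    (h : F ≤ C * (A ^ (β / (α + β)) * B ^ (α / (α + β)))) :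
    F ≤ (C * K ^ (β / (α + β))) ^ ((α + β) / α) * B := by
  have hs : 0 < α + β := by positivity
  have ha : 0 < α / (α + β) := by positivity
  have hb : 0 < β / (α + β) := by positivity
  have h1 : F ^ (β / (α + β)) * F ^ (α / (α + β)) = F := by
    rw [← ENNReal.rpow_add _ _ hF hF', ← add_div, add_comm β, div_self hs.ne', ENNReal.rpow_one]
  have h2 : F ^ (α / (α + β)) ≤ C * K ^ (β / (α + β)) * B ^ (α / (α + β)) := by
    refine (ENNReal.mul_le_mul_iff_right (a := F ^ (β / (α + β)))
      (by simp [ENNReal.rpow_eq_zero_iff, hF, hF'])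
      (ENNReal.rpow_ne_top_of_nonneg hb.le hF')).1 ?_
    calc _ = F := h1
      _ ≤ C * ((K * F) ^ (β / (α + β)) * B ^ (α / (α + β))) := h.trans (by gcongr)
      _ = _ := by
        rw [ENNReal.mul_rpow_of_nonneg _ _ hb.le]
        ring
  have hone : α / (α + β) * ((α + β) / α) = 1 := by field_simp
  have h3 := ENNReal.rpow_le_rpow h2 (by positivity : 0 ≤ (α + β) / α)
  rwa [ENNReal.mul_rpow_of_nonneg _ _ (by positivity), ← ENNReal.rpow_mul, ← ENNReal.rpow_mul,
    hone, ENNReal.rpow_one, ENNReal.rpow_one] at h3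

theorem integrable_norm_rpow_mul_gaussian_rpow (V : Type*) [NormedAddCommGroup V]
    [InnerProductSpace ℝ V] [FiniteDimensional ℝ V] [MeasurableSpace V] [BorelSpace V]
    [Nontrivial V] {α r : ℝ} (hα : 0 ≤ α) (hr : 0 < r) :
    Integrable fun x : V => (‖x‖ ^ α * Real.exp (-Real.pi * ‖x‖ ^ 2)) ^ r := by
  rw [integrable_fun_norm_addHaar volume
    (f := fun y => (y ^ α * Real.exp (-Real.pi * y ^ 2)) ^ r)]
  have hd : 0 < Module.finrank ℝ V := Module.finrank_pos
  have hn : ((Module.finrank ℝ V - 1 : ℕ) : ℝ) = Module.finrank ℝ V - 1 := by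
    rw [Nat.cast_sub hd, Nat.cast_one]
  have hd' : (0 : ℝ) < Module.finrank ℝ V := by exact_mod_cast hd
  refine (integrableOn_rpow_mul_exp_neg_mul_sq (b := Real.pi * r) (by positivity)
    (by have := mul_nonneg hα hr.le; linarith :
      -1 < (Module.finrank ℝ V : ℝ) - 1 + α * r)).congr_fun (fun y hy => ?_) measurableSet_Ioi
  have hy : 0 < y := hy
  simp only [smul_eq_mul]
  rw [← Real.rpow_natCast y (_ - 1), hn, Real.mul_rpow (by positivity) (by positivity),
    ← Real.rpow_mul hy.le, ← Real.exp_mul, Real.rpow_add hy]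
  ring_nf

/-- Necessity of the condition on `β`, for a general Euclidean space. -/
theorem SchwartzMap.lt_of_forall_eLpNorm_le {V : Type*} [NormedAddCommGroup V]
    [InnerProductSpace ℝ V] [FiniteDimensional ℝ V] [MeasurableSpace V] [BorelSpace V]
    [Nontrivial V] {q q' : ℝ≥0∞} (hq : 1 ≤ q) (hq2 : q < 2) (hconj : 1 / q + 1 / q' = 1)
    {α β : ℝ} (hα : 0 < α) (hβ : 0 < β) {C : ℝ≥0∞} (hC : C ≠ ∞)
    (h : ∀ f : SchwartzMap V ℂ, eLpNorm f q volume ≤ C *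
      (eLpNorm (fun x => ‖x‖ ^ α * ‖f x‖) q volume ^ (β / (α + β)) *
        eLpNorm (fun ξ => ‖ξ‖ ^ β * ‖𝓕 (f : V → ℂ) ξ‖) q' volume ^ (α / (α + β)))) :
    (Module.finrank ℝ V : ℝ) * ((1 / q).toReal - 1 / 2) < β := by
  by_contra! hle
  simp only [one_div q, one_div q'] at hconj hle
  have hqt : q ≠ ∞ := (hq2.trans ENNReal.ofNat_lt_top).ne
  have hq0 : q ≠ 0 := (one_pos.trans_le hq).ne'
  have hq' : 1 ≤ q' := ENNReal.inv_le_one.1 (hconj ▸ le_add_self)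
  have hd : (0 : ℝ) < Module.finrank ℝ V := by exact_mod_cast Module.finrank_pos
  have hsum : q⁻¹.toReal + q'⁻¹.toReal = 1 := by
    rw [← ENNReal.toReal_add (by simpa) (by simpa using (one_pos.trans_le hq').ne'), hconj,
      ENNReal.toReal_one]
  set r := q.toReal with hr
  have hrq : q⁻¹.toReal = r⁻¹ := ENNReal.toReal_inv q
  have hr0 : 0 < r := ENNReal.toReal_pos hq0 hqt
  have hr2 : r < 2 := by
    simpa using (ENNReal.toReal_lt_toReal hqt ENNReal.ofNat_ne_top).2 hq2
  have he0 : 0 ≤ q'⁻¹.toReal := ENNReal.toReal_nonneg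
  set e := q'⁻¹.toReal with he
  have he2 : e < 1 / 2 := by
    have : (2 : ℝ)⁻¹ < r⁻¹ := inv_strictAnti₀ hr0 hr2
    rw [hrq] at hsum
    linarith
  have hγ : 0 < β + Module.finrank ℝ V * e := by positivity
  have hγn : β + Module.finrank ℝ V * e ≤ Module.finrank ℝ V / 2 := by
    rw [eq_sub_of_add_eq hsum] at hle
    linarith
  obtain ⟨C₁, hC₁, hfreq⟩ := exists_eLpNorm_rpow_norm_mul_sum_le (V := V) hq' hγ rfl hγn
  set γ := β + Module.finrank ℝ V * e
  choose g a ha ha1 hga hgF using fun k : ℕ => SchwartzMap.exists_chirp V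
    (w := 2 ^ ((k : ℝ) / γ)) (Real.one_le_rpow one_le_two (by positivity))
  set G : V → ℝ := fun x => Real.exp (-Real.pi * ‖x‖ ^ 2) with hG
  have hG0 : ∀ x, 0 < G x := fun x => Real.exp_pos _
  have i₀ : Integrable fun x : V => G x ^ r := by
    simpa only [Real.rpow_zero, one_mul] using
      integrable_norm_rpow_mul_gaussian_rpow V le_rfl hr0
  have i₁ : Integrable fun x : V => (‖x‖ ^ α * G x) ^ r :=
    integrable_norm_rpow_mul_gaussian_rpow V hα.le hr0
  have hpos : 0 < ∫ x, G x ^ r := by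
    refine integral_pos_of_integrable_nonneg_nonzero (x := 0) ?_ i₀
      (fun x => (Real.rpow_pos_of_pos (hG0 x) r).le) (Real.rpow_pos_of_pos (hG0 0) r).ne'
    simp only [hG]
    exact (by fun_prop : Continuous fun x : V => Real.exp (-Real.pi * ‖x‖ ^ 2)).rpow_const
      fun _ => Or.inr hr0.le
  obtain ⟨l, c, hl, hc, hlc⟩ := exists_signedSum_integral_le i₀ i₁
    (fun x => (Real.rpow_pos_of_pos (hG0 x) r).le) (fun x => by have := hG0 x; positivity)
    hpos hr0.le hr2.le
  set K := ENNReal.ofReal ((l⁻¹) ^ r⁻¹)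
  set D := (C * K ^ (β / (α + β))) ^ ((α + β) / α) * C₁
  have hD : D ≠ ∞ := ENNReal.mul_ne_top (ENNReal.rpow_ne_top_of_nonneg (by positivity)
    (ENNReal.mul_ne_top hC (ENNReal.rpow_ne_top_of_nonneg (by positivity)
      ENNReal.ofReal_ne_top))) hC₁
  have main : ∀ J : ℕ, 0 < J → ENNReal.ofReal ((c * (J : ℝ) ^ (r / 2)) ^ r⁻¹) ≤
      D * (J : ℝ≥0∞) ^ e := fun J hJ => by
    have hJ' : (0 : ℝ) < J := by exact_mod_cast hJ
    obtain ⟨S, hS⟩ := hlc a (fun k => (ha k).measurable) ha1 J hJ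
    have hi := integrable_mul_norm_signedSum_rpow i₁ (fun k => (ha k).measurable) ha1 hr0.le J S
    set f : SchwartzMap V ℂ := signedSum g J S with hf
    have hfn : ∀ x, ‖f x‖ = G x * ‖signedSum (fun k => a k x) J S‖ := fun x => by
      have h1 := map_signedSum (AddMonoidHom.mulLeft (G x : ℂ)) (fun k => a k x) J S
      simp only [AddMonoidHom.coe_mulLeft] at h1
      rw [hf, SchwartzMap.signedSum_apply]
      simp only [hga]
      rw [← h1, norm_mul, Complex.norm_real, Real.norm_of_nonneg (hG0 x).le]
    have e₀ : ∀ x, G x ^ r * ‖signedSum (fun k => a k x) J S‖ ^ r = ‖f x‖ ^ r := fun x => by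
      rw [hfn, Real.mul_rpow (hG0 x).le (norm_nonneg _)]
    have e₁ : ∀ x, (‖x‖ ^ α * G x) ^ r * ‖signedSum (fun k => a k x) J S‖ ^ r =
        ‖‖x‖ ^ α * ‖f x‖‖ ^ r := fun x => by
      have := hG0 x
      rw [Real.norm_of_nonneg (by positivity), hfn, ← mul_assoc,
        Real.mul_rpow (by positivity) (norm_nonneg _)]
    simp only [e₀, e₁] at hS hi
    have hm : AEStronglyMeasurable (fun x => ‖x‖ ^ α * ‖f x‖) volume :=
      ((continuous_norm.rpow_const fun _ => Or.inr hα.le).mul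
        f.continuous.norm).aestronglyMeasurable
    have hmem : MemLp (fun x => ‖x‖ ^ α * ‖f x‖) q volume :=
      (integrable_norm_rpow_iff hm hq0 hqt).1 hi
    have hF := (f.memLp q volume).eLpNorm_eq_integral_rpow_norm hq0 hqt
    have hA := hmem.eLpNorm_eq_integral_rpow_norm hq0 hqt
    rw [← hr] at hF hA
    have hA0 : 0 ≤ ∫ x, ‖‖x‖ ^ α * ‖f x‖‖ ^ r := integral_nonneg fun x => by positivity
    have hcJ : 0 < c * (J : ℝ) ^ (r / 2) := by positivity
    have hFc : c * (J : ℝ) ^ (r / 2) ≤ ∫ x, ‖f x‖ ^ r := by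
      have := mul_nonneg hl.le hA0
      linarith
    have hAF : eLpNorm (fun x => ‖x‖ ^ α * ‖f x‖) q volume ≤ K * eLpNorm f q volume := by
      rw [hF, hA, ← ENNReal.ofReal_mul (by positivity),
        ← Real.mul_rpow (by positivity) (hcJ.le.trans hFc)]
      refine ENNReal.ofReal_le_ofReal (Real.rpow_le_rpow hA0 ?_ (by positivity))
      rw [inv_mul_eq_div, le_div_iff₀' hl]
      linarith
    have hF0 : eLpNorm f q volume ≠ 0 := by
      rw [hF]
      exact (ENNReal.ofReal_pos.2 (Real.rpow_pos_of_pos (hcJ.trans_le hFc) _)).ne'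
    calc _ ≤ eLpNorm f q volume := by
          rw [hF]
          exact ENNReal.ofReal_le_ofReal (Real.rpow_le_rpow hcJ.le hFc (by positivity))
      _ ≤ _ := ENNReal.le_mul_of_le_mul_rpow_mul_rpow hα hβ hF0
          (f.memLp q volume).eLpNorm_ne_top hAF (h f)
      _ ≤ (C * K ^ (β / (α + β))) ^ ((α + β) / α) * (C₁ * (J : ℝ≥0∞) ^ e) := by
          refine mul_le_mul_right (hfreq J _ fun ξ => ?_) _
          simpa only [hgF] using SchwartzMap.norm_fourier_signedSum_le g J S ξ
      _ = _ := (mul_assoc _ _ _).symm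
  have hlim : Filter.Tendsto (fun J : ℕ => c ^ r⁻¹ * (J : ℝ) ^ (1 / 2 - e)) Filter.atTop
      Filter.atTop :=
    ((tendsto_rpow_atTop (sub_pos.2 he2)).comp tendsto_natCast_atTop_atTop).const_mul_atTop
      (Real.rpow_pos_of_pos hc _)
  obtain ⟨J, hJ, hJ0⟩ := ((hlim.eventually_gt_atTop D.toReal).and
    (Filter.eventually_gt_atTop 0)).exists
  have hJ' : (0 : ℝ) < J := by exact_mod_cast hJ0
  have h1 := ENNReal.toReal_mono (ENNReal.mul_ne_top hD
    (ENNReal.rpow_ne_top_of_nonneg he0 (ENNReal.natCast_ne_top J))) (main J hJ0)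
  rw [ENNReal.toReal_ofReal (by positivity), ENNReal.toReal_mul, ← ENNReal.toReal_rpow,
    ENNReal.toReal_natCast, Real.mul_rpow hc.le (by positivity), ← Real.rpow_mul hJ'.le,
    show r / 2 * r⁻¹ = 1 / 2 - e + e by field_simp; ring, Real.rpow_add hJ', ← mul_assoc] at h1
  exact (le_of_mul_le_mul_right h1 (Real.rpow_pos_of_pos hJ' e)).not_gt hJ

/-- The case `p = q'` of the non-symmetric Heisenberg uncertainty principle
(inequality (1.4) and its characterization). -/
theorem heisenberg_dual_exponent_characterization
    (d : ℕ) (hd : 1 ≤ d) (q q' : ℝ≥0∞) (hq : 1 ≤ q) (hq' : q ≠ ∞)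
    (hconj : 1/q + 1/q' = 1)
    (α β : ℝ) (hα : 0 < α) (hβ : 0 < β) :
    (∃ C : ℝ, 0 < C ∧
      ∀ f : SchwartzMap (EuclideanSpace ℝ (Fin d)) ℂ,
        eLpNorm (⇑f) q volume ≤ ENNReal.ofReal C *
          ((eLpNorm (fun x => ‖x‖ ^ α * ‖f x‖) q volume) ^ (β / (α + β)) *
            (eLpNorm (fun ξ => ‖ξ‖ ^ β * ‖𝓕 (⇑f) ξ‖) q' volume) ^ (α / (α + β)))) ↔
    (q < 2 → β > (d : ℝ) * ((1/q).toReal - 1/2)) := by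
  have : Nontrivial (EuclideanSpace ℝ (Fin d)) :=
    Module.nontrivial_of_finrank_pos (R := ℝ) (by rw [finrank_euclideanSpace_fin]; omega)
  constructor
  · rintro ⟨C, -, hC⟩ hq2
    have h := SchwartzMap.lt_of_forall_eLpNorm_le hq hq2 hconj hα hβ ENNReal.ofReal_ne_top hC
    rwa [finrank_euclideanSpace_fin] at h
  · intro hcond
    refine SchwartzMap.exists_eLpNorm_le_mul_rpow hq hq' hconj hα hβ fun hq2 => ?_
    rw [finrank_euclideanSpace_fin]
    exact hcond hq2
end

section
/- Let d ≥ 1, 2 ≤ q ≤ ∞, and let A = (A₁,A₂), B = (B₁,B₂) be pairs with A₁,A₂,B₁,B₂ > 0. Then there exists a constant C such that for every nonzero Schwartz function f on ℝ^d, writing X = ‖ x^A f ‖_q / ‖ ξ^B f̂ ‖_{q′}, one has ‖f‖_q ≤ C ‖ ξ^B f̂ ‖_{q′} · X^{e(X)}, where e(X) = B₂/(A₁+B₂) if X < 1 and e(X) = B₁/(A₂+B₁) if X ≥ 1. -/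
open MeasureTheory
open scoped ENNReal FourierTransform

/-- The broken power weight `x^A`: `|x|^{A₁}` for `|x| < 1`, `|x|^{A₂}` for `|x| ≥ 1`. -/
noncomputable def brokenWeight {d : ℕ} (A : ℝ × ℝ) (x : EuclideanSpace ℝ (Fin d)) : ℝ :=
  if ‖x‖ < 1 then ‖x‖ ^ A.1 else ‖x‖ ^ A.2


section HausdorffYoung

variable {E : Type*} [NormedAddCommGroup E] [InnerProductSpace ℝ E] [FiniteDimensional ℝ E]
  [MeasurableSpace E] [BorelSpace E]

theorem continuous_fourier_of_integrable {g : E → ℂ} (hg : Integrable g) :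
    Continuous (𝓕 g) :=
  VectorFourier.fourierIntegral_continuous (L := innerₗ E) Real.continuous_fourierChar
    continuous_inner hg

theorem enorm_fourier_le_lintegral (g : E → ℂ) (x : E) : ‖𝓕 g x‖ₑ ≤ ∫⁻ y, ‖g y‖ₑ := by
  rw [Real.fourier_eq]
  refine (enorm_integral_le_lintegral_enorm _).trans (le_of_eq ?_)
  congr 1 with y
  rw [← ofReal_norm, ← ofReal_norm, Circle.norm_smul]

/-- The classical Fourier transform agrees with the `L²` one on `L¹ ∩ L²`. -/
theorem fourier_ae_eq_Lp_fourier {g : E → ℂ} (h1 : Integrable g) (h2 : MemLp g 2) :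
    𝓕 g =ᵐ[volume] (𝓕 (h2.toLp g) : Lp (α := E) ℂ 2) := by
  refine ae_eq_of_integral_contDiff_smul_eq
    (continuous_fourier_of_integrable h1).locallyIntegrable
    ((Lp.memLp _).locallyIntegrable (by norm_num)) fun φ hφ hc ↦ ?_
  have hc' : HasCompactSupport (fun x ↦ (φ x : ℂ)) :=
    hc.comp_left (g := fun t : ℝ ↦ (t : ℂ)) (by simp)
  let ψ : SchwartzMap E ℂ := hc'.toSchwartzMap (Complex.ofRealCLM.contDiff.comp hφ)
  have hψ : ∀ x, ψ x = (φ x : ℂ) := fun x ↦ rfl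
  have e1 : ∫ x, 𝓕 (⇑ψ) x • g x = ∫ x, ψ x • 𝓕 g x :=
    VectorFourier.integral_fourierIntegral_smul_eq_flip (L := innerₗ E)
      Real.continuous_fourierChar continuous_inner ψ.integrable h1 |>.trans (by simp; rfl)
  have e2 := congrArg (fun T ↦ T ψ) (Lp.fourier_toTemperedDistribution_eq (h2.toLp g))
  simp only [TemperedDistribution.fourier_apply, Lp.toTemperedDistribution_apply] at e2
  have e3 : ∫ x, (𝓕 ψ) x • (h2.toLp g) x = ∫ x, 𝓕 (⇑ψ) x • g x := by
    refine integral_congr_ae ?_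
    filter_upwards [h2.coeFn_toLp] with x hx
    rw [hx, SchwartzMap.fourier_coe]
  rw [e3, e1] at e2
  simpa [hψ] using e2

/-- Plancherel's theorem on `L¹ ∩ L²`. -/
theorem eLpNorm_fourier_two {g : E → ℂ} (h1 : Integrable g) (h2 : MemLp g 2) :
    eLpNorm (𝓕 g) 2 volume = eLpNorm g 2 volume := by
  rw [eLpNorm_congr_ae (fourier_ae_eq_Lp_fourier h1 h2), ← Lp.enorm_def]
  conv_rhs => rw [← Lp.enorm_toLp h2]
  rw [← ofReal_norm, ← ofReal_norm, Lp.norm_fourier_eq]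

/-- Splitting `g` at height `(2n/t)^(q-1)`, the large part contributes at most `t/2` to `𝓕 g`,
and the small part is controlled by Plancherel and Chebyshev. -/
theorem volume_lt_norm_fourier_le {q n t : ℝ} (hq : 2 < q) (hn : 0 < n) (ht : 0 < t)
    {g : E → ℂ} (hgm : Measurable g) (h1 : Integrable g) (h2 : MemLp g 2)
    (hN : ∫⁻ y, ‖g y‖ₑ ^ (q / (q - 1)) = ENNReal.ofReal n) :
    volume {x | t < ‖𝓕 g x‖} ≤ ENNReal.ofReal (4 / t ^ 2) *
      ∫⁻ y, if ‖g y‖ ≤ (2 * n / t) ^ (q - 1) then ‖g y‖ₑ ^ 2 else 0 := by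
  set s := (2 * n / t) ^ (q - 1) with hs
  have hs0 : 0 < s := by positivity
  set S : Set E := {y | ‖g y‖ ≤ s} with hS
  have hSm : MeasurableSet S := measurableSet_le hgm.norm measurable_const
  set g₁ := Sᶜ.indicator g
  set g₂ := S.indicator g
  have i1 : Integrable g₁ := h1.indicator hSm.compl
  have i2 : Integrable g₂ := h1.indicator hSm
  have m2 : MemLp g₂ 2 := h2.indicator hSm
  have hsplit : ∀ x, 𝓕 g x = 𝓕 g₁ x + 𝓕 g₂ x := by
    intro x
    have : g = g₁ + g₂ := (Set.indicator_compl_add_self S g).symm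
    conv_lhs => rw [this]
    simp only [Real.fourier_eq, Pi.add_apply, smul_add]
    exact integral_add ((Real.fourierIntegral_convergent_iff x).2 i1)
      ((Real.fourierIntegral_convergent_iff x).2 i2)
  have hlarge : ∀ x, ‖𝓕 g₁ x‖ ≤ t / 2 := by
    intro x
    have key : ∫⁻ y, ‖g₁ y‖ₑ ≤ ENNReal.ofReal (t / 2) := by
      calc ∫⁻ y, ‖g₁ y‖ₑ
          ≤ ∫⁻ y, ENNReal.ofReal (t / (2 * n)) * ‖g y‖ₑ ^ (q / (q - 1)) := by
            refine lintegral_mono fun y ↦ ?_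
            by_cases hy : y ∈ S
            · simp [g₁, hy]
            · have hy' : s < ‖g y‖ := by simpa [hS] using hy
              have hpos : 0 < ‖g y‖ := hs0.trans hy'
              simp only [g₁, Set.indicator_of_mem (Set.mem_compl hy)]
              rw [← ofReal_norm, ENNReal.ofReal_rpow_of_pos hpos,
                ← ENNReal.ofReal_mul (by positivity)]
              refine ENNReal.ofReal_le_ofReal ?_
              have e : q / (q - 1) = 1 + 1 / (q - 1) := by
                field_simp [show q - 1 ≠ 0 by linarith]; ring
              rw [e, Real.rpow_add hpos, Real.rpow_one]
              have h3 : 2 * n / t ≤ ‖g y‖ ^ (1 / (q - 1)) := by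
                have := Real.rpow_le_rpow hs0.le hy'.le
                  (show 0 ≤ 1 / (q - 1) from div_nonneg zero_le_one (by linarith))
                rwa [hs, ← Real.rpow_mul (by positivity), mul_one_div_cancel (by linarith),
                  Real.rpow_one] at this
              calc ‖g y‖ = t / (2 * n) * (‖g y‖ * (2 * n / t)) := by field_simp
                _ ≤ _ := by gcongr
        _ = ENNReal.ofReal (t / 2) := by
            rw [lintegral_const_mul' _ _ ENNReal.ofReal_ne_top, hN,
              ← ENNReal.ofReal_mul (by positivity)]
            congr 1
            field_simp
    have := (enorm_fourier_le_lintegral g₁ x).trans key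
    rwa [← ofReal_norm, ENNReal.ofReal_le_ofReal_iff (by positivity)] at this
  have hsub : {x | t < ‖𝓕 g x‖} ⊆ {x | ENNReal.ofReal (t ^ 2 / 4) ≤ ‖𝓕 g₂ x‖ₑ ^ 2} := by
    intro x hx
    have h3 : t < ‖𝓕 g₁ x + 𝓕 g₂ x‖ := by rw [← hsplit]; exact hx
    have h4 : t / 2 ≤ ‖𝓕 g₂ x‖ := by
      have := norm_add_le (𝓕 g₁ x) (𝓕 g₂ x)
      linarith [hlarge x]
    rw [Set.mem_ofPred_eq, ← ofReal_norm, ← ENNReal.ofReal_pow (norm_nonneg _)]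
    refine ENNReal.ofReal_le_ofReal ?_
    nlinarith
  have hcheb := mul_meas_ge_le_lintegral (μ := (volume : Measure E))
    (f := fun x ↦ ‖𝓕 g₂ x‖ₑ ^ 2)
    ((continuous_fourier_of_integrable i2).measurable.enorm.pow_const 2)
    (ENNReal.ofReal (t ^ 2 / 4))
  have hpl : ∫⁻ x, ‖𝓕 g₂ x‖ₑ ^ 2 = ∫⁻ x, ‖g₂ x‖ₑ ^ 2 := by
    have := eLpNorm_fourier_two i2 m2
    refine ENNReal.rpow_left_injective (x := 2⁻¹) (by norm_num) ?_
    simpa [eLpNorm_eq_lintegral_rpow_enorm_toReal] using this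
  have hg₂ : ∫⁻ x, ‖g₂ x‖ₑ ^ 2 = ∫⁻ y, if ‖g y‖ ≤ s then ‖g y‖ₑ ^ 2 else 0 := by
    refine lintegral_congr fun y ↦ ?_
    by_cases hy : ‖g y‖ ≤ s
    · simp [g₂, hS, hy]
    · simp [g₂, hS, hy]
  rw [hpl, hg₂] at hcheb
  calc volume {x | t < ‖𝓕 g x‖}
      ≤ volume {x | ENNReal.ofReal (t ^ 2 / 4) ≤ ‖𝓕 g₂ x‖ₑ ^ 2} := measure_mono hsub
    _ = ENNReal.ofReal (4 / t ^ 2) * (ENNReal.ofReal (t ^ 2 / 4) *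
          volume {x | ENNReal.ofReal (t ^ 2 / 4) ≤ ‖𝓕 g₂ x‖ₑ ^ 2}) := by
        rw [← mul_assoc, ← ENNReal.ofReal_mul (by positivity)]
        rw [show 4 / t ^ 2 * (t ^ 2 / 4) = 1 by field_simp]
        simp
    _ ≤ _ := by gcongr

theorem lintegral_Ioc_rpow {r L : ℝ} (hr : 0 < r) (hL : 0 ≤ L) :
    ∫⁻ t in Set.Ioc 0 L, ENNReal.ofReal (t ^ (r - 1)) = ENNReal.ofReal (L ^ r / r) := by
  rw [← ofReal_integral_eq_lintegral_ofReal,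
    ← intervalIntegral.integral_of_le hL, integral_rpow (Or.inl (by linarith))]
  · simp [Real.zero_rpow hr.ne']
  · exact (intervalIntegrable_iff_integrableOn_Ioc_of_le hL).1
      (intervalIntegral.intervalIntegrable_rpow' (by linarith))
  · filter_upwards [ae_restrict_mem measurableSet_Ioc] with t ht
    exact Real.rpow_nonneg ht.1.le _

/-- The Hausdorff–Young inequality (up to a constant) by real interpolation between the endpoints
`L¹ → L^∞` and `L² → L²`. -/
theorem lintegral_enorm_fourier_rpow_le {q n : ℝ} (hq : 2 < q) (hn : 0 < n)
    {g : E → ℂ} (hgm : Measurable g) (h1 : Integrable g) (h2 : MemLp g 2)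
    (hN : ∫⁻ y, ‖g y‖ₑ ^ (q / (q - 1)) = ENNReal.ofReal n) :
    ∫⁻ x, ‖𝓕 g x‖ₑ ^ q ≤
      ENNReal.ofReal (4 * q * 2 ^ (q - 2) / (q - 2) * n ^ (q - 1)) := by
  have hq2 : 0 < q - 2 := by linarith
  have hq1 : 0 < q - 1 := by linarith
  have hF : ∀ x, ‖𝓕 g x‖ₑ ^ q = ENNReal.ofReal (‖𝓕 g x‖ ^ q) := fun x ↦ by
    rw [← ofReal_norm, ENNReal.ofReal_rpow_of_nonneg (norm_nonneg _) (by linarith)]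
  simp_rw [hF]
  rw [lintegral_rpow_eq_lintegral_meas_lt_mul (μ := volume) (f := fun x ↦ ‖𝓕 g x‖)
    (Filter.Eventually.of_forall fun _ ↦ norm_nonneg _)
    (continuous_fourier_of_integrable h1).norm.measurable.aemeasurable (by linarith)]
  let H : ℝ → E → ℝ≥0∞ := fun t y ↦ ENNReal.ofReal (4 * t ^ (q - 2 - 1)) *
    (if ‖g y‖ ≤ (2 * n / t) ^ (q - 1) then ‖g y‖ₑ ^ 2 else 0)
  have hH : Measurable (Function.uncurry H) := by
    refine Measurable.mul (by fun_prop) (Measurable.ite ?_ (by fun_prop) measurable_const)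
    exact measurableSet_le (by fun_prop) (by fun_prop)
  have step1 : ∫⁻ t in Set.Ioi (0 : ℝ), volume {x | t < ‖𝓕 g x‖} * ENNReal.ofReal (t ^ (q - 1))
      ≤ ∫⁻ t in Set.Ioi (0 : ℝ), ∫⁻ y, H t y := by
    refine setLIntegral_mono' measurableSet_Ioi fun t ht ↦ ?_
    have ht : 0 < t := ht
    calc volume {x | t < ‖𝓕 g x‖} * ENNReal.ofReal (t ^ (q - 1))
        ≤ (ENNReal.ofReal (4 / t ^ 2) *
          ∫⁻ y, if ‖g y‖ ≤ (2 * n / t) ^ (q - 1) then ‖g y‖ₑ ^ 2 else 0) *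
            ENNReal.ofReal (t ^ (q - 1)) := by
          gcongr
          exact volume_lt_norm_fourier_le hq hn ht hgm h1 h2 hN
      _ = ∫⁻ y, H t y := by
          simp only [H]
          rw [lintegral_const_mul' _ _ ENNReal.ofReal_ne_top, mul_right_comm,
            ← ENNReal.ofReal_mul (by positivity)]
          congr 2
          rw [show q - 1 = (q - 2 - 1) + 2 by ring, Real.rpow_add ht]
          norm_num
          field_simp
  have step2 : ∀ y, ∫⁻ t in Set.Ioi (0 : ℝ), H t y ≤
      ENNReal.ofReal (4 * (2 * n) ^ (q - 2) / (q - 2)) * ‖g y‖ₑ ^ (q / (q - 1)) := by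
    intro y
    rcases eq_or_ne (g y) 0 with hy | hy
    · simp [H, hy]
    have ha : 0 < ‖g y‖ := norm_pos_iff.2 hy
    set a := ‖g y‖ with haa
    set L := 2 * n * a ^ (-(1 / (q - 1))) with hL
    have hL0 : 0 < L := by positivity
    calc ∫⁻ t in Set.Ioi (0 : ℝ), H t y
        ≤ ∫⁻ t in Set.Ioi (0 : ℝ), (Set.Ioc 0 L).indicator
            (fun t ↦ ENNReal.ofReal (4 * a ^ 2) * ENNReal.ofReal (t ^ (q - 2 - 1))) t := by
          refine setLIntegral_mono' measurableSet_Ioi fun t ht ↦ ?_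
          have ht : 0 < t := ht
          simp only [H]
          split_ifs with hc
          · have htL : t ≤ L := by
              have := Real.rpow_le_rpow ha.le hc (show 0 ≤ 1 / (q - 1) by positivity)
              rw [← Real.rpow_mul (by positivity), mul_one_div_cancel hq1.ne', Real.rpow_one,
                le_div_iff₀ ht] at this
              rw [hL, Real.rpow_neg ha.le, ← div_eq_mul_inv, le_div_iff₀ (by positivity)]
              linarith
            rw [Set.indicator_of_mem (Set.mem_Ioc.2 ⟨ht, htL⟩), ← ofReal_norm, ← haa,
              ← ENNReal.ofReal_pow ha.le, ← ENNReal.ofReal_mul (by positivity),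
              ← ENNReal.ofReal_mul (by positivity)]
            refine le_of_eq ?_
            congr 1
            ring
          · simp
      _ = ENNReal.ofReal (4 * a ^ 2) * ENNReal.ofReal (L ^ (q - 2) / (q - 2)) := by
          rw [setLIntegral_indicator measurableSet_Ioc,
            Set.inter_eq_left.2 Set.Ioc_subset_Ioi_self,
            lintegral_const_mul' _ _ ENNReal.ofReal_ne_top, lintegral_Ioc_rpow hq2 hL0.le]
      _ = _ := by
          rw [← ofReal_norm, ← haa, ENNReal.ofReal_rpow_of_pos ha,
            ← ENNReal.ofReal_mul (by positivity), ← ENNReal.ofReal_mul (by positivity)]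
          congr 1
          have e : a ^ (q / (q - 1)) = a ^ 2 * a ^ (-(1 / (q - 1)) * (q - 2)) := by
            rw [← Real.rpow_natCast, ← Real.rpow_add ha]
            congr 1
            field_simp
            push_cast
            ring
          rw [e, hL, Real.mul_rpow (by positivity) (by positivity), ← Real.rpow_mul ha.le]
          ring
  calc ENNReal.ofReal q * ∫⁻ t in Set.Ioi (0 : ℝ), volume {x | t < ‖𝓕 g x‖} *
        ENNReal.ofReal (t ^ (q - 1))
      ≤ ENNReal.ofReal q * ∫⁻ t in Set.Ioi (0 : ℝ), ∫⁻ y, H t y := by gcongr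
    _ = ENNReal.ofReal q * ∫⁻ y, ∫⁻ t in Set.Ioi (0 : ℝ), H t y := by
        rw [lintegral_lintegral_swap hH.aemeasurable]
    _ ≤ ENNReal.ofReal q * ∫⁻ y, ENNReal.ofReal (4 * (2 * n) ^ (q - 2) / (q - 2)) *
          ‖g y‖ₑ ^ (q / (q - 1)) := by
        gcongr with y
        exact step2 y
    _ = _ := by
        rw [lintegral_const_mul' _ _ ENNReal.ofReal_ne_top, hN,
          ← ENNReal.ofReal_mul (by positivity), ← ENNReal.ofReal_mul (by positivity)]
        congr 1
        rw [show q - 1 = (q - 2) + 1 by ring, Real.rpow_add hn, Real.rpow_one,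
          Real.mul_rpow (by norm_num) hn.le]
        ring

theorem eLpNorm_fourierInv (g : E → ℂ) (q : ℝ≥0∞) (hg : Integrable g) :
    eLpNorm (𝓕⁻ g) q volume = eLpNorm (𝓕 g) q volume := by
  have : 𝓕⁻ g = 𝓕 g ∘ Neg.neg := funext fun x ↦ Real.fourierInv_eq_fourier_neg g x
  rw [this]
  exact eLpNorm_comp_measurePreserving
    (continuous_fourier_of_integrable hg).aestronglyMeasurable (Measure.measurePreserving_neg _)

/-- The Hausdorff–Young inequality, up to a constant, on `L¹ ∩ L²`. -/
theorem exists_eLpNorm_fourierInv_le {q q' : ℝ≥0∞} (hq : 2 ≤ q) (hconj : 1 / q + 1 / q' = 1) :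
    ∃ C : ℝ, 0 < C ∧ ∀ g : E → ℂ, Measurable g → Integrable g → MemLp g 2 →
      eLpNorm (𝓕⁻ g) q volume ≤ ENNReal.ofReal C * eLpNorm g q' volume := by
  rcases eq_or_ne q ∞ with rfl | hqt
  · have hq' : q' = 1 := by simpa using hconj
    subst hq'
    refine ⟨1, one_pos, fun g _ h1 _ ↦ ?_⟩
    rw [eLpNorm_fourierInv g _ h1, ENNReal.ofReal_one, one_mul, eLpNorm_exponent_top,
      eLpNorm_one_eq_lintegral_enorm]
    exact eLpNormEssSup_le_of_ae_enorm_bound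
      (Filter.Eventually.of_forall (enorm_fourier_le_lintegral g))
  obtain ⟨r, hr, hr2⟩ : ∃ r : ℝ, q = ENNReal.ofReal r ∧ 2 ≤ r := by
    refine ⟨q.toReal, (ENNReal.ofReal_toReal hqt).symm, ?_⟩
    simpa using ENNReal.toReal_mono hqt hq
  have hq' : q' = ENNReal.ofReal (r / (r - 1)) := by
    have h := (((Real.holderConjugate_iff_eq_conjExponent (p := r) (by linarith)).2
      rfl).inv_add_inv_ennreal).symm
    rw [← hconj, one_div, one_div, hr] at h
    refine inv_injective ((ENNReal.add_right_inj ?_).1 h)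
    simp only [ne_eq, ENNReal.inv_eq_top, ENNReal.ofReal_eq_zero, not_le]
    linarith
  subst hr hq'
  rcases hr2.eq_or_lt with rfl | hr2
  · refine ⟨1, one_pos, fun g _ h1 h2 ↦ ?_⟩
    norm_num
    rw [eLpNorm_fourierInv g _ h1, eLpNorm_fourier_two h1 h2]
  have hr0 : 0 < r := by linarith
  have hr1 : 0 < r - 1 := by linarith
  have hr3 : 0 < r - 2 := by linarith
  have hp : 0 < r / (r - 1) := by positivity
  set K : ℝ := 4 * r * 2 ^ (r - 2) / (r - 2) with hK
  have hK0 : 0 < K := by positivity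
  refine ⟨K ^ (1 / r), by positivity, fun g hgm h1 h2 ↦ ?_⟩
  rw [eLpNorm_fourierInv g _ h1,
    eLpNorm_eq_lintegral_rpow_enorm_toReal (by simpa using hr0) ENNReal.ofReal_ne_top,
    eLpNorm_eq_lintegral_rpow_enorm_toReal (by simpa using hp) ENNReal.ofReal_ne_top,
    ENNReal.toReal_ofReal hr0.le, ENNReal.toReal_ofReal hp.le]
  rcases eq_or_ne (∫⁻ y, ‖g y‖ₑ ^ (r / (r - 1))) ∞ with hN | hN
  · rw [hN, ENNReal.top_rpow_of_pos (by positivity), ENNReal.mul_top (by simp; positivity)]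
    exact le_top
  rcases eq_or_ne (∫⁻ y, ‖g y‖ₑ ^ (r / (r - 1))) 0 with hN0 | hN0
  · rw [lintegral_eq_zero_iff (by fun_prop)] at hN0
    have hg0 : ∀ᵐ y, g y = 0 := by
      filter_upwards [hN0] with y hy
      simpa [hp, hp.le, hp.ne', not_lt.2 hp.le] using hy
    have hF : 𝓕 g = 0 := by
      ext x
      rw [Real.fourier_eq]
      refine integral_eq_zero_of_ae ?_
      filter_upwards [hg0] with y hy
      simp [hy]
    simp [hF, hr0]
  obtain ⟨n, hn, hNn⟩ : ∃ n : ℝ, 0 < n ∧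
      ∫⁻ y, ‖g y‖ₑ ^ (r / (r - 1)) = ENNReal.ofReal n :=
    ⟨_, ENNReal.toReal_pos hN0 hN, (ENNReal.ofReal_toReal hN).symm⟩
  have := lintegral_enorm_fourier_rpow_le hr2 hn hgm h1 h2 hNn
  rw [hNn]
  calc _ ≤ ENNReal.ofReal (K * n ^ (r - 1)) ^ (1 / r) := by gcongr
    _ = _ := by
      rw [ENNReal.ofReal_rpow_of_pos (by positivity), ENNReal.ofReal_rpow_of_pos hn,
        ← ENNReal.ofReal_mul (by positivity), Real.mul_rpow hK0.le (by positivity),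
        ← Real.rpow_mul hn.le]
      congr 3
      field_simp

end HausdorffYoung

section Difference

variable {E : Type*} [NormedAddCommGroup E] [InnerProductSpace ℝ E] [FiniteDimensional ℝ E]
  [MeasurableSpace E] [BorelSpace E]

theorem norm_fourierChar_sub_one_le (s : ℝ) :
    ‖(Real.fourierChar s : ℂ) - 1‖ ≤ 2 * Real.pi * min 1 |s| := by
  rw [mul_min_of_nonneg _ _ (by positivity)]
  refine le_min ?_ ?_
  · have h := norm_sub_le (Real.fourierChar s : ℂ) 1
    have := Real.pi_gt_three
    simp only [Circle.norm_coe, norm_one] at h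
    linarith
  · rw [Real.fourierChar_apply, mul_comm _ Complex.I]
    refine Real.norm_exp_I_mul_ofReal_sub_one_le.trans (le_of_eq ?_)
    rw [norm_mul, Real.norm_eq_abs, Real.norm_eq_abs, abs_of_pos Real.two_pi_pos]

/-- The inverse Fourier transform of `(e^{2πi⟨h,ξ⟩} - 1)^m f̂(ξ)` is the `m`-th difference of `f`. -/
theorem fourierInv_fourierChar_sub_one_pow_mul (f : SchwartzMap E ℂ) (h x : E) (m : ℕ) :
    𝓕⁻ (fun ξ ↦ ((Real.fourierChar (inner ℝ h ξ) : ℂ) - 1) ^ m * 𝓕 (⇑f) ξ) x =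
      ∑ k ∈ Finset.range (m + 1), (-1) ^ (m - k) * (m.choose k : ℂ) * f (x + (k : ℝ) • h) := by
  have hinv : ∀ y, f y = ∫ ξ, Real.fourierChar (inner ℝ ξ y) • 𝓕 (⇑f) ξ := by
    intro y
    rw [← Real.fourierInv_eq, ← SchwartzMap.fourier_coe, ← SchwartzMap.fourierInv_coe]
    simp
  have hint : ∀ y, Integrable fun ξ ↦ Real.fourierChar (inner ℝ ξ y) • 𝓕 (⇑f) ξ := by
    intro y
    have := (Real.fourierIntegral_convergent_iff (-y)).2
      ((𝓕 f).integrable (μ := volume))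
    simpa [SchwartzMap.fourier_coe] using this
  rw [Real.fourierInv_eq]
  simp_rw [hinv, ← integral_const_mul]
  rw [← integral_finsetSum _ fun k _ ↦ (hint _).const_mul _]
  congr 1 with ξ
  rw [sub_eq_add_neg, add_pow, Finset.sum_mul, Finset.smul_sum]
  refine Finset.sum_congr rfl fun k _ ↦ ?_
  have : (Real.fourierChar (inner ℝ ξ (x + (k : ℝ) • h)) : ℂ) =
      Real.fourierChar (inner ℝ ξ x) * (Real.fourierChar (inner ℝ h ξ) : ℂ) ^ k := by
    rw [inner_add_right, inner_smul_right, AddChar.map_add_eq_mul, real_inner_comm ξ h,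
      ← nsmul_eq_mul, AddChar.map_nsmul_eq_pow]
    simp
  simp only [Circle.smul_def, smul_eq_mul, this]
  ring

end Difference

section BrokenPower

/-- The radial profile of `brokenWeight`. -/
noncomputable def brokenPow (A : ℝ × ℝ) (t : ℝ) : ℝ :=
  if t < 1 then t ^ A.1 else t ^ A.2

theorem brokenWeight_eq {d : ℕ} (A : ℝ × ℝ) (x : EuclideanSpace ℝ (Fin d)) :
    brokenWeight A x = brokenPow A ‖x‖ := rfl

theorem brokenPow_pos (A : ℝ × ℝ) {t : ℝ} (ht : 0 < t) : 0 < brokenPow A t := by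
  unfold brokenPow
  split_ifs <;> positivity

theorem brokenPow_nonneg (A : ℝ × ℝ) {t : ℝ} (ht : 0 ≤ t) : 0 ≤ brokenPow A t := by
  unfold brokenPow
  split_ifs <;> positivity

theorem brokenPow_mono {A : ℝ × ℝ} (h1 : 0 < A.1) (h2 : 0 < A.2) {s t : ℝ} (hs : 0 ≤ s)
    (hst : s ≤ t) : brokenPow A s ≤ brokenPow A t := by
  unfold brokenPow
  split_ifs with hs1 ht1 ht1
  · exact Real.rpow_le_rpow hs hst h1.le
  · exact (Real.rpow_le_one hs hs1.le h1.le).trans (Real.one_le_rpow (not_lt.1 ht1) h2.le)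
  · linarith
  · exact Real.rpow_le_rpow hs hst h2.le

theorem measurable_brokenPow (A : ℝ × ℝ) : Measurable (brokenPow A) :=
  Measurable.ite measurableSet_Iio (by fun_prop) (by fun_prop)

theorem brokenPow_le_one_add_sq_pow {A : ℝ × ℝ} (h1 : 0 < A.1) {N : ℕ} (hN : A.2 ≤ N) {t : ℝ}
    (ht : 0 ≤ t) : brokenPow A t ≤ (1 + t ^ 2) ^ N := by
  unfold brokenPow
  split_ifs with ht1
  · exact (Real.rpow_le_one ht ht1.le h1.le).trans (one_le_pow₀ (by nlinarith))
  · have ht1 : 1 ≤ t := not_lt.1 ht1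
    calc t ^ A.2 ≤ t ^ (N : ℝ) := Real.rpow_le_rpow_of_exponent_le ht1 hN
      _ = t ^ N := Real.rpow_natCast _ _
      _ ≤ _ := pow_le_pow_left₀ ht (by nlinarith) N

theorem min_one_pow_le_rpow {u b : ℝ} {m : ℕ} (hu : 0 < u) (hb : 0 ≤ b) (hbm : b ≤ m) :
    (min 1 u) ^ m ≤ u ^ b := by
  rcases le_total u 1 with h | h
  · rw [min_eq_right h, ← Real.rpow_natCast]
    exact Real.rpow_le_rpow_of_exponent_ge hu h hbm
  · rw [min_eq_left h, one_pow]
    exact Real.one_le_rpow h hb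

theorem min_one_mul_pow_le_brokenPow {B : ℝ × ℝ} (h1 : 0 < B.1) (h2 : 0 < B.2) {m : ℕ}
    (hm1 : B.1 ≤ m) (hm2 : B.2 ≤ m) {r s : ℝ} (hr : 0 < r) (hs : 0 ≤ s) :
    (min 1 (r * s)) ^ m ≤ brokenPow (B.2, B.1) r * brokenPow B s := by
  rcases hs.eq_or_lt with rfl | hs
  · have hm : m ≠ 0 := by
      rintro rfl
      norm_num at hm1
      linarith
    rw [mul_zero, min_eq_right zero_le_one, zero_pow hm]
    exact mul_nonneg (brokenPow_nonneg _ hr.le) (brokenPow_nonneg _ le_rfl)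
  have hu : 0 < r * s := mul_pos hr hs
  have b1 := min_one_pow_le_rpow hu h1.le hm1
  have b2 := min_one_pow_le_rpow hu h2.le hm2
  rw [Real.mul_rpow hr.le hs.le] at b1 b2
  unfold brokenPow
  split_ifs with hr1 hs1 hs1
  · rcases le_total B.1 B.2 with h | h
    · refine b2.trans ?_
      exact mul_le_mul_of_nonneg_left (Real.rpow_le_rpow_of_exponent_ge hs hs1.le h)
        (by positivity)
    · refine b1.trans ?_
      exact mul_le_mul_of_nonneg_right (Real.rpow_le_rpow_of_exponent_ge hr hr1.le h)
        (by positivity)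
  · exact b2
  · exact b1
  · refine (pow_le_one₀ (by positivity) (min_le_left _ _)).trans ?_
    exact one_le_mul_of_one_le_of_one_le (Real.one_le_rpow (not_lt.1 hr1) h1.le)
      (Real.one_le_rpow (not_lt.1 hs1) h2.le)

variable {d : ℕ}

theorem measurable_brokenWeight (A : ℝ × ℝ) :
    Measurable (brokenWeight A : EuclideanSpace ℝ (Fin d) → ℝ) :=
  (measurable_brokenPow A).comp measurable_norm

theorem eLpNorm_brokenWeight_mul_lt_top {A : ℝ × ℝ} (h1 : 0 < A.1)
    (f : SchwartzMap (EuclideanSpace ℝ (Fin d)) ℂ) (q : ℝ≥0∞) :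
    eLpNorm (fun x ↦ brokenWeight A x * ‖f x‖) q volume < ∞ := by
  obtain ⟨N, hN⟩ := exists_nat_ge A.2
  let w : EuclideanSpace ℝ (Fin d) → ℝ := fun x ↦ (1 + ‖x‖ ^ 2) ^ N
  have hw : w.HasTemperateGrowth := by
    have h2 : Function.HasTemperateGrowth fun x : EuclideanSpace ℝ (Fin d) ↦ 1 + ‖x‖ ^ 2 := by
      fun_prop
    exact h2.pow N
  let F := SchwartzMap.smulLeftCLM ℂ w f
  have hle : ∀ x, ‖brokenWeight A x * ‖f x‖‖ ≤ ‖F x‖ := by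
    intro x
    have hF : F x = w x • f x := SchwartzMap.smulLeftCLM_apply_apply hw f x
    rw [hF, norm_smul, norm_mul, norm_norm]
    refine mul_le_mul_of_nonneg_right ?_ (norm_nonneg _)
    rw [brokenWeight_eq, Real.norm_of_nonneg (brokenPow_nonneg _ (norm_nonneg _))]
    exact (brokenPow_le_one_add_sq_pow h1 hN (norm_nonneg _)).trans (le_abs_self _)
  exact lt_of_le_of_lt (eLpNorm_mono (g := F) hle) (F.memLp q volume).eLpNorm_lt_top

theorem eLpNorm_brokenWeight_mul_ne_zero (hd : 1 ≤ d) (A : ℝ × ℝ)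
    {g : EuclideanSpace ℝ (Fin d) → ℂ} (hgc : Continuous g) (hg : g ≠ 0) {q : ℝ≥0∞}
    (hq : q ≠ 0) : eLpNorm (fun x ↦ brokenWeight A x * ‖g x‖) q volume ≠ 0 := by
  have : Nonempty (Fin d) := ⟨⟨0, hd⟩⟩
  intro h
  have hm : Measurable fun x ↦ brokenWeight A x * ‖g x‖ :=
    (measurable_brokenWeight A).mul hgc.norm.measurable
  rw [eLpNorm_eq_zero_iff hm.aestronglyMeasurable hq] at h
  have h0 : ∀ᵐ x : EuclideanSpace ℝ (Fin d), x ≠ 0 := by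
    simp [ae_iff]
  refine hg ((hgc.ae_eq_iff_eq volume continuous_zero).1 ?_)
  filter_upwards [h, h0] with x hx hx0
  have := (brokenPow_pos A (norm_pos_iff.2 hx0)).ne'
  simpa [brokenWeight_eq, this] using hx

end BrokenPower

section Uncertainty

variable {d : ℕ}

/-- Inside the ball of radius `r`, a function is controlled by its `m`-th difference with step `h`,
`‖h‖ = 2r`, and by its values outside the ball. -/
theorem norm_le_norm_sum_add_sum_of_norm_eq {E : Type*} [NormedAddCommGroup E] [NormedSpace ℝ E]
    (f : E → ℂ) {r : ℝ} {h : E} (hh : ‖h‖ = 2 * r) (m : ℕ) (x : E) :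
    ‖f x‖ ≤ ‖∑ k ∈ Finset.range (m + 1), (-1) ^ (m - k) * (m.choose k : ℂ) * f (x + (k : ℝ) • h)‖ +
      ∑ k ∈ Finset.range (m + 1), (m.choose k : ℝ) *
        (if r ≤ ‖x + (k : ℝ) • h‖ then ‖f (x + (k : ℝ) • h)‖ else 0) := by
  have hnn : ∀ k : ℕ, 0 ≤ (m.choose k : ℝ) *
      (if r ≤ ‖x + (k : ℝ) • h‖ then ‖f (x + (k : ℝ) • h)‖ else 0) := by
    intro k
    split_ifs <;> positivity
  by_cases hx : r ≤ ‖x‖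
  · have := Finset.single_le_sum (s := Finset.range (m + 1)) (fun k _ ↦ hnn k)
      (Finset.mem_range.2 (Nat.succ_pos m))
    simp only [Nat.choose_zero_right, Nat.cast_one, Nat.cast_zero, zero_smul, add_zero, hx,
      if_true, one_mul] at this
    exact this.trans (le_add_of_nonneg_left (norm_nonneg _))
  · have hx : ‖x‖ < r := not_le.1 hx
    have hfar : ∀ k : ℕ, r ≤ ‖x + ((k + 1 : ℕ) : ℝ) • h‖ := by
      intro k
      have h1 : ‖((k + 1 : ℕ) : ℝ) • h‖ = (k + 1) * (2 * r) := by
        rw [norm_smul, hh, Real.norm_natCast]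
        push_cast
        rfl
      have h2 := norm_sub_le (x + ((k + 1 : ℕ) : ℝ) • h) x
      rw [add_sub_cancel_left, h1] at h2
      have : 0 < r := (norm_nonneg x).trans_lt hx
      have : 0 ≤ (k : ℝ) * r := by positivity
      nlinarith
    rw [Finset.sum_range_succ' _ m, Finset.sum_range_succ' _ m]
    simp only [hfar, if_true]
    set S := ∑ k ∈ Finset.range m, (-1) ^ (m - (k + 1)) * (m.choose (k + 1) : ℂ) *
      f (x + ((k + 1 : ℕ) : ℝ) • h)
    have hS : ‖S‖ ≤ ∑ k ∈ Finset.range m, (m.choose (k + 1) : ℝ) *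
        ‖f (x + ((k + 1 : ℕ) : ℝ) • h)‖ := by
      refine (norm_sum_le _ _).trans (le_of_eq (Finset.sum_congr rfl fun k _ ↦ ?_))
      simp
    have h0 := hnn 0
    set z := (-1) ^ (m - 0) * (m.choose 0 : ℂ) * f (x + ((0 : ℕ) : ℝ) • h) with hz
    have hz' : ‖z‖ = ‖f x‖ := by simp [hz]
    have := norm_sub_le (S + z) S
    rw [add_sub_cancel_left, hz'] at this
    linarith

theorem exists_eLpNorm_le_add (hd : 1 ≤ d) {q q' : ℝ≥0∞} (hq : 2 ≤ q)
    (hconj : 1 / q + 1 / q' = 1) {A B : ℝ × ℝ} (hA1 : 0 < A.1) (hA2 : 0 < A.2) (hB1 : 0 < B.1)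
    (hB2 : 0 < B.2) :
    ∃ K : ℝ, 0 < K ∧ ∀ (f : SchwartzMap (EuclideanSpace ℝ (Fin d)) ℂ) (r : ℝ), 0 < r →
      eLpNorm (⇑f) q volume ≤ ENNReal.ofReal K *
        (ENNReal.ofReal (brokenPow (B.2, B.1) r) *
            eLpNorm (fun ξ ↦ brokenWeight B ξ * ‖𝓕 (⇑f) ξ‖) q' volume +
          ENNReal.ofReal (brokenPow A r)⁻¹ *
            eLpNorm (fun x ↦ brokenWeight A x * ‖f x‖) q volume) := by
  obtain ⟨C, hC, hHY⟩ := exists_eLpNorm_fourierInv_le (E := EuclideanSpace ℝ (Fin d)) hq hconj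
  obtain ⟨m, hm⟩ := exists_nat_ge (max B.1 B.2)
  have hm1 : B.1 ≤ m := (le_max_left _ _).trans hm
  have hm2 : B.2 ≤ m := (le_max_right _ _).trans hm
  have hq1 : 1 ≤ q := le_trans (by norm_num) hq
  refine ⟨C * (4 * Real.pi) ^ m + 2 ^ m, by positivity, fun f r hr ↦ ?_⟩
  set U := eLpNorm (fun x ↦ brokenWeight A x * ‖f x‖) q volume
  set V := eLpNorm (fun ξ ↦ brokenWeight B ξ * ‖𝓕 (⇑f) ξ‖) q' volume
  have hρ := brokenPow_pos (B.2, B.1) hr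
  have hw := brokenPow_pos A hr
  let h : EuclideanSpace ℝ (Fin d) := EuclideanSpace.single ⟨0, hd⟩ (2 * r)
  have hh : ‖h‖ = 2 * r := by
    simp [h, abs_of_pos hr]
  let G : EuclideanSpace ℝ (Fin d) → ℂ :=
    fun ξ ↦ ((Real.fourierChar (inner ℝ h ξ) : ℂ) - 1) ^ m * 𝓕 (⇑f) ξ
  have hfc : Continuous (𝓕 (⇑f)) := (𝓕 f).continuous
  have hGc : Continuous G := by
    have : Continuous fun ξ : EuclideanSpace ℝ (Fin d) ↦
        (Real.fourierChar (inner ℝ h ξ) : ℂ) :=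
      continuous_subtype_val.comp
        (Real.continuous_fourierChar.comp (continuous_const.inner continuous_id))
    exact ((this.sub continuous_const).pow m).mul hfc
  have hmult : ∀ ξ : EuclideanSpace ℝ (Fin d),
      ‖((Real.fourierChar (inner ℝ h ξ) : ℂ) - 1) ^ m‖ ≤
        (4 * Real.pi) ^ m * (min 1 (r * ‖ξ‖)) ^ m := by
    intro ξ
    rw [norm_pow, ← mul_pow]
    refine pow_le_pow_left₀ (norm_nonneg _) ((norm_fourierChar_sub_one_le _).trans ?_) m
    have h1 : |inner ℝ h ξ| ≤ 2 * (r * ‖ξ‖) := by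
      have := abs_real_inner_le_norm h ξ
      rw [hh] at this
      linarith
    have h2 : min 1 |inner ℝ h ξ| ≤ 2 * min 1 (r * ‖ξ‖) := by
      rw [mul_min_of_nonneg _ _ (by norm_num)]
      exact min_le_min (by norm_num) h1
    nlinarith [Real.pi_pos]
  have hGle : ∀ ξ, ‖G ξ‖ ≤ (4 * Real.pi) ^ m * ‖(𝓕 f) ξ‖ := by
    intro ξ
    rw [norm_mul]
    refine mul_le_mul_of_nonneg_right ((hmult ξ).trans ?_) (norm_nonneg _)
    exact mul_le_of_le_one_right (by positivity)
      (pow_le_one₀ (by positivity) (min_le_left _ _))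
  have hGp : ∀ p : ℝ≥0∞, MemLp G p volume := fun p ↦
    ((𝓕 f).memLp p volume).of_le_mul hGc.aestronglyMeasurable (Filter.Eventually.of_forall hGle)
  have hGV : eLpNorm G q' volume ≤
      ENNReal.ofReal ((4 * Real.pi) ^ m * brokenPow (B.2, B.1) r) * V := by
    refine eLpNorm_le_mul_eLpNorm_of_ae_le_mul (Filter.Eventually.of_forall fun ξ ↦ ?_) q'
    rw [norm_mul, norm_mul, norm_norm, ← mul_assoc]
    refine mul_le_mul_of_nonneg_right ((hmult ξ).trans ?_) (norm_nonneg _)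
    rw [brokenWeight_eq, Real.norm_of_nonneg (brokenPow_nonneg _ (norm_nonneg _)), mul_assoc]
    gcongr
    exact min_one_mul_pow_le_brokenPow hB1 hB2 hm1 hm2 hr (norm_nonneg _)
  let φ : EuclideanSpace ℝ (Fin d) → ℝ := fun y ↦ if r ≤ ‖y‖ then ‖f y‖ else 0
  have hφm : Measurable φ :=
    Measurable.ite (measurableSet_le measurable_const measurable_norm)
      f.continuous.norm.measurable measurable_const
  have hφU : eLpNorm φ q volume ≤ ENNReal.ofReal (brokenPow A r)⁻¹ * U := by
    refine eLpNorm_le_mul_eLpNorm_of_ae_le_mul (Filter.Eventually.of_forall fun y ↦ ?_) q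
    simp only [φ]
    split_ifs with hy
    · rw [norm_mul, norm_norm, brokenWeight_eq,
        Real.norm_of_nonneg (brokenPow_nonneg _ (norm_nonneg _)), ← mul_assoc]
      refine le_mul_of_one_le_left (norm_nonneg _) ?_
      rw [inv_mul_eq_div, one_le_div hw]
      exact brokenPow_mono hA1 hA2 hr.le hy
    · rw [norm_zero]
      positivity
  have hpt : ∀ x, ‖f x‖ ≤ ‖𝓕⁻ G x‖ +
      ∑ k ∈ Finset.range (m + 1), (m.choose k : ℝ) * φ (x + (k : ℝ) • h) := by
    intro x
    rw [fourierInv_fourierChar_sub_one_pow_mul f h x m]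
    exact norm_le_norm_sum_add_sum_of_norm_eq f hh m x
  have hGi : AEStronglyMeasurable (𝓕⁻ G) volume := by
    have : Continuous (𝓕⁻ G) := by
      have h2 : 𝓕⁻ G = 𝓕 G ∘ Neg.neg := funext fun x ↦ Real.fourierInv_eq_fourier_neg G x
      rw [h2]
      exact (continuous_fourier_of_integrable (memLp_one_iff_integrable.1 (hGp 1))).comp
        continuous_neg
    exact this.aestronglyMeasurable
  have hshift : ∀ k : ℕ, Measurable fun x ↦ (m.choose k : ℝ) * φ (x + (k : ℝ) • h) :=
    fun k ↦ (hφm.comp (measurable_add_const _)).const_mul _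
  have hsum : eLpNorm (fun x ↦ ∑ k ∈ Finset.range (m + 1),
      (m.choose k : ℝ) * φ (x + (k : ℝ) • h)) q volume ≤
        ENNReal.ofReal (2 ^ m) * eLpNorm φ q volume := by
    have e : (fun x ↦ ∑ k ∈ Finset.range (m + 1), (m.choose k : ℝ) * φ (x + (k : ℝ) • h)) =
        ∑ k ∈ Finset.range (m + 1), fun x ↦ (m.choose k : ℝ) * φ (x + (k : ℝ) • h) := by
      ext x
      simp
    rw [e]
    refine (eLpNorm_sum_le (fun k _ ↦ (hshift k).aestronglyMeasurable) hq1).trans ?_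
    have e2 : ∀ k : ℕ, eLpNorm (fun x ↦ (m.choose k : ℝ) * φ (x + (k : ℝ) • h)) q volume =
        (m.choose k : ℝ≥0∞) * eLpNorm φ q volume := by
      intro k
      have e3 := eLpNorm_const_smul (m.choose k : ℝ) (φ ∘ fun x ↦ x + (k : ℝ) • h) q
        (volume : Measure (EuclideanSpace ℝ (Fin d)))
      rw [eLpNorm_comp_measurePreserving hφm.aestronglyMeasurable
        (measurePreserving_add_right volume _)] at e3
      rw [← ofReal_norm, Real.norm_natCast, ENNReal.ofReal_natCast] at e3
      exact e3
    simp_rw [e2]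
    rw [← Finset.sum_mul, ← Nat.cast_sum, Nat.sum_range_choose,
      ENNReal.ofReal_pow (by norm_num)]
    simp
  calc eLpNorm (⇑f) q volume
      ≤ eLpNorm (fun x ↦ ‖𝓕⁻ G x‖ +
          ∑ k ∈ Finset.range (m + 1), (m.choose k : ℝ) * φ (x + (k : ℝ) • h)) q volume :=
        eLpNorm_mono_real hpt
    _ ≤ eLpNorm (fun x ↦ ‖𝓕⁻ G x‖) q volume + eLpNorm (fun x ↦ ∑ k ∈ Finset.range (m + 1),
          (m.choose k : ℝ) * φ (x + (k : ℝ) • h)) q volume :=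
        eLpNorm_add_le hGi.norm
          (Finset.measurable_sum _ fun k _ ↦ hshift k).aestronglyMeasurable hq1
    _ ≤ ENNReal.ofReal C * (ENNReal.ofReal ((4 * Real.pi) ^ m * brokenPow (B.2, B.1) r) * V) +
          ENNReal.ofReal (2 ^ m) * (ENNReal.ofReal (brokenPow A r)⁻¹ * U) := by
        rw [eLpNorm_norm]
        gcongr
        · exact (hHY G hGc.measurable (memLp_one_iff_integrable.1 (hGp 1)) (hGp 2)).trans
            (by gcongr)
        · exact hsum.trans (by gcongr)
    _ = ENNReal.ofReal (C * (4 * Real.pi) ^ m) * (ENNReal.ofReal (brokenPow (B.2, B.1) r) * V) +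
          ENNReal.ofReal (2 ^ m) * (ENNReal.ofReal (brokenPow A r)⁻¹ * U) := by
        rw [ENNReal.ofReal_mul (by positivity), ENNReal.ofReal_mul hC.le]
        ring
    _ ≤ _ := by
        rw [mul_add]
        gcongr
        · exact le_add_of_nonneg_right (by positivity)
        · exact le_add_of_nonneg_left (by positivity)

/-- Optimal choice of the radius: `ρ(r) + X / w(r) = 2 X^e` for `r = X^{1/(a+b)}`. -/
theorem exists_brokenPow_add_mul_inv_le {A B : ℝ × ℝ} (hA1 : 0 < A.1) (hA2 : 0 < A.2)
    (hB1 : 0 < B.1) (hB2 : 0 < B.2) {X : ℝ} (hX : 0 < X) :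
    ∃ r : ℝ, 0 < r ∧ brokenPow (B.2, B.1) r + (brokenPow A r)⁻¹ * X =
      2 * X ^ (if X < 1 then B.2 / (A.1 + B.2) else B.1 / (A.2 + B.1)) := by
  have key : ∀ a b : ℝ, 0 < a → 0 < b → ((X ^ (1 / (a + b))) ^ b = X ^ (b / (a + b)) ∧
      ((X ^ (1 / (a + b))) ^ a)⁻¹ * X = X ^ (b / (a + b))) := by
    intro a b ha hb
    constructor
    · rw [← Real.rpow_mul hX.le]
      congr 1
      ring
    · rw [← Real.rpow_mul hX.le, ← Real.rpow_neg hX.le]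
      nth_rewrite 2 [← Real.rpow_one X]
      rw [← Real.rpow_add hX]
      congr 1
      field_simp
      ring
  split_ifs with h
  · obtain ⟨k1, k2⟩ := key A.1 B.2 hA1 hB2
    refine ⟨X ^ (1 / (A.1 + B.2)), by positivity, ?_⟩
    have hr : X ^ (1 / (A.1 + B.2)) < 1 := Real.rpow_lt_one hX.le h (by positivity)
    simp only [brokenPow, hr, if_true]
    rw [k1, k2, two_mul]
  · obtain ⟨k1, k2⟩ := key A.2 B.1 hA2 hB1
    refine ⟨X ^ (1 / (A.2 + B.1)), by positivity, ?_⟩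
    have hr : ¬ X ^ (1 / (A.2 + B.1)) < 1 :=
      not_lt.2 (Real.one_le_rpow (not_lt.1 h) (by positivity))
    simp only [brokenPow, hr, if_false]
    rw [k1, k2, two_mul]

end Uncertainty

/-- Corollary 1.3: weighted Hausdorff–Young type inequality with broken power weights. -/
theorem heisenberg_broken_hausdorff_young
    (d : ℕ) (hd : 1 ≤ d) (q q' : ℝ≥0∞) (hq : 2 ≤ q) (hconj : 1/q + 1/q' = 1)
    (A B : ℝ × ℝ) (hA1 : 0 < A.1) (hA2 : 0 < A.2) (hB1 : 0 < B.1) (hB2 : 0 < B.2) :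
    ∃ C : ℝ, 0 < C ∧
      ∀ f : SchwartzMap (EuclideanSpace ℝ (Fin d)) ℂ, f ≠ 0 →
        eLpNorm (⇑f) q volume ≤ ENNReal.ofReal C *
          (eLpNorm (fun ξ => brokenWeight B ξ * ‖𝓕 (⇑f) ξ‖) q' volume *
            (eLpNorm (fun x => brokenWeight A x * ‖f x‖) q volume /
              eLpNorm (fun ξ => brokenWeight B ξ * ‖𝓕 (⇑f) ξ‖) q' volume) ^
            (if (eLpNorm (fun x => brokenWeight A x * ‖f x‖) q volume /
                  eLpNorm (fun ξ => brokenWeight B ξ * ‖𝓕 (⇑f) ξ‖) q' volume) < 1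
              then B.2 / (A.1 + B.2) else B.1 / (A.2 + B.1))) := by
  obtain ⟨K, hK, hmain⟩ := exists_eLpNorm_le_add hd hq hconj hA1 hA2 hB1 hB2
  refine ⟨2 * K, by positivity, fun f hf ↦ ?_⟩
  have hq0 : q ≠ 0 := fun h ↦ by simp [h] at hq
  have hq'0 : q' ≠ 0 := fun h ↦ by simp [h] at hconj
  have hf0 : (⇑f : EuclideanSpace ℝ (Fin d) → ℂ) ≠ 0 := fun h ↦ hf (DFunLike.coe_injective h)
  have hF0 : 𝓕 (⇑f) ≠ 0 := fun h ↦ hf <| by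
    have h0 : (𝓕 f : SchwartzMap (EuclideanSpace ℝ (Fin d)) ℂ) = 0 := DFunLike.coe_injective h
    have e : 𝓕⁻ (𝓕 f : SchwartzMap (EuclideanSpace ℝ (Fin d)) ℂ) = f :=
      FourierTransform.fourierInv_fourier_eq f
    rw [← e, h0]
    exact (FourierTransform.fourierInvCLM ℂ (SchwartzMap (EuclideanSpace ℝ (Fin d)) ℂ)).map_zero
  have hU0 := eLpNorm_brokenWeight_mul_ne_zero hd A f.continuous hf0 hq0
  have hV0 := eLpNorm_brokenWeight_mul_ne_zero hd B (𝓕 f).continuous hF0 hq'0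
  have hUt := (eLpNorm_brokenWeight_mul_lt_top hA1 f q).ne
  have hVt := (eLpNorm_brokenWeight_mul_lt_top hB1 (𝓕 f) q').ne
  rw [SchwartzMap.fourier_coe] at hVt
  have hf_le := hmain f
  set U := eLpNorm (fun x => brokenWeight A x * ‖f x‖) q volume
  set V := eLpNorm (fun ξ => brokenWeight B ξ * ‖𝓕 (⇑f) ξ‖) q' volume
  set X := (U / V).toReal with hXdef
  have hUV : U / V = ENNReal.ofReal X :=
    (ENNReal.ofReal_toReal (ENNReal.div_ne_top hUt hV0)).symm
  have hX : 0 < X := ENNReal.toReal_pos (ENNReal.div_ne_zero.2 ⟨hU0, hVt⟩)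
    (ENNReal.div_ne_top hUt hV0)
  have hU : U = ENNReal.ofReal X * V := by
    rw [← hUV, ENNReal.div_mul_cancel hV0 hVt]
  obtain ⟨r, hr, hrX⟩ := exists_brokenPow_add_mul_inv_le hA1 hA2 hB1 hB2 hX
  have hρ := (brokenPow_pos (B.2, B.1) hr).le
  have hw := (inv_pos.2 (brokenPow_pos A hr)).le
  refine (hf_le r hr).trans (le_of_eq ?_)
  simp only [hUV, ENNReal.ofReal_lt_one]
  rw [ENNReal.ofReal_rpow_of_pos hX, hU, ← mul_assoc (ENNReal.ofReal _⁻¹),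
    ← ENNReal.ofReal_mul hw, ← add_mul, ← ENNReal.ofReal_add hρ (by positivity), hrX,
    ← mul_assoc, ← ENNReal.ofReal_mul hK.le, mul_comm V, ← mul_assoc (ENNReal.ofReal (2 * K)),
    ← ENNReal.ofReal_mul (by positivity)]
  congr 2
  ring
end
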